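/- arXiv:2311.05148 — 4 statements merged into one kernel-verified Lean document; each statement's English description precedes it below -/
import Mathlib

section
/- There exist absolute constants c > 0 and C > 0 such that the following holds. Let p be a prime, let A, B ⊆ F_p with |A| ≤ |B|, and let L be a set of affine lines in F_p^2 with |A|·|L| ≤ c·p^2. Then I(A × B, L) ≤ C·( |A|^{3/4} |B|^{1/2} |L|^{3/4} + |A|·|B| + |L| ). -/
/-- `ℓ ⊆ F^2` is an affine line if it is given by an equation `a x + b y = c`
with `(a, b) ≠ (0, 0)`. -/
def IsLine {F : Type*} [Field F] (ℓ : Set (F × F)) : Prop :=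
  ∃ a b c : F, (a ≠ 0 ∨ b ≠ 0) ∧ ℓ = {z : F × F | a * z.1 + b * z.2 = c}

/-- `nIncidences P L` is `I(P, L)`, the number of pairs `(z, ℓ) ∈ P × L` with `z ∈ ℓ`. -/
noncomputable def nIncidences {F : Type*} (P : Set (F × F)) (L : Set (Set (F × F))) : ℕ :=
  {zl : (F × F) × Set (F × F) | zl.1 ∈ P ∧ zl.2 ∈ L ∧ zl.1 ∈ zl.2}.ncard

section Bezout

open MvPolynomial

variable {K : Type*} [Field K]

theorem finrank_restrictTotalDegree_fin_three (n : ℕ) :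
    Module.finrank K (restrictTotalDegree (Fin 3) K n) = (n + 3).choose 3 := by
  have h := Module.finrank_eq_nat_card_basis
    (basisRestrictSupport K {s : Fin 3 →₀ ℕ | (s.sum fun _ e => e) ≤ n})
  have h2 : {s : Fin 3 →₀ ℕ | (s.sum fun _ e => e) ≤ n} =
      (((Finset.range (n + 1)).biUnion
        fun i => (Finset.univ : Finset (Fin 3)).finsuppAntidiag i : Finset (Fin 3 →₀ ℕ)) :
          Set (Fin 3 →₀ ℕ)) := by
    ext s
    simp [Finset.mem_finsuppAntidiag, Finsupp.sum_fintype]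
  rw [restrictTotalDegree, h, h2]
  rw [Nat.card_coe_set_eq, Set.ncard_coe_finset, Finset.card_biUnion]
  · simp only [Finset.card_finsuppAntidiag_nat_eq_multichoose]
    simpa using Nat.sum_range_multichoose n 3
  · intro i _ j _ hij
    rw [Function.onFun, Finset.disjoint_left]
    intro a ha hb
    rw [Finset.mem_finsuppAntidiag] at ha hb
    exact hij (ha.1.symm.trans hb.1)

theorem le_mul_of_choose_three_le {a d e N r : ℕ} (ha : a + d + e = r + N)
    (hr : r = N ^ 2 + d + e + d * e)
    (h4 : (a + e + 3).choose 3 + (a + d + 3).choose 3 + N * (r + 1) ≤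
      (a + d + e + 3).choose 3 + (a + 3).choose 3) : N ≤ d * e := by
  have hch : ∀ n : ℕ, ((n + 3).choose 3 * 6 : ℤ) = (n + 1) * (n + 2) * (n + 3) := by
    intro n
    have := Nat.descFactorial_eq_factorial_mul_choose (n + 3) 3
    simp [Nat.descFactorial, Nat.factorial] at this
    zify at this
    linear_combination -this
  by_contra hcon
  push Not at hcon
  zify at h4 ha hr hcon
  have h5 : (N * (r + 1) * 6 : ℤ) ≤ 3 * d * e * (2 * a + d + e + 4) := by
    have e1 := hch (a + e)
    have e2 := hch (a + d)
    have e3 := hch (a + d + e)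
    have e4 := hch a
    push_cast at e1 e2 e3 e4
    nlinarith
  have h6 : (2 * a + d + e + 4 : ℤ) ≤ 2 * (r + N + 2) := by lia
  have h7 : (N * (r + 1) : ℤ) ≤ d * e * (r + N + 2) := by
    have : (3 * d * e * (2 * a + d + e + 4) : ℤ) ≤ 3 * d * e * (2 * (r + N + 2)) := by gcongr
    linarith
  have h8 : ((d * e + 1) * (r + 1) : ℤ) ≤ N * (r + 1) := by gcongr; lia
  have h9 : (d * e * (N + 1) : ℤ) ≤ (N - 1) * (N + 1) := by gcongr; lia
  nlinarith

/-- Restriction to the line `x = t.2.2`, `z = t.1 * y + t.2.1` of the plane `x = t.2.2`. -/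
noncomputable def lineEval (t : K × K × K) : MvPolynomial (Fin 3) K →ₐ[K] Polynomial K :=
  aeval ![Polynomial.C t.2.2, Polynomial.X, Polynomial.C t.1 * Polynomial.X + Polynomial.C t.2.1]

/-- Restriction to the line `y = t.2.2`, `z = t.1 * x + t.2.1` of the plane `y = t.2.2`. -/
noncomputable def lineEval' (t : K × K × K) : MvPolynomial (Fin 3) K →ₐ[K] Polynomial K :=
  aeval ![Polynomial.X, Polynomial.C t.2.2, Polynomial.C t.1 * Polynomial.X + Polynomial.C t.2.1]

theorem natDegree_lineEval_le (t : K × K × K) (f : MvPolynomial (Fin 3) K) :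
    (lineEval t f).natDegree ≤ f.totalDegree := by
  have := aeval_natDegree_le (n := 1) f le_rfl
    ![Polynomial.C t.2.2, Polynomial.X, Polynomial.C t.1 * Polynomial.X + Polynomial.C t.2.1] (by
      intro i
      fin_cases i
      · simp
      · simp
      · exact Polynomial.natDegree_linear_le)
  rwa [mul_one] at this

theorem lineEval'_eq (t : K × K × K) (f : MvPolynomial (Fin 3) K) :
    lineEval' t f = lineEval t (rename (Equiv.swap 0 1) f) := by
  rw [lineEval, lineEval', aeval_rename]
  congr 2
  funext i
  fin_cases i <;> rfl

theorem natDegree_lineEval'_le (t : K × K × K) (f : MvPolynomial (Fin 3) K) :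
    (lineEval' t f).natDegree ≤ f.totalDegree := by
  rw [lineEval'_eq]
  exact (natDegree_lineEval_le t _).trans (totalDegree_rename_le _ _)

/-- Two relatively prime polynomials of degrees `d` and `e` vanish simultaneously on at most `d e`
lines in distinct planes `x = const`. -/
theorem card_lines_le_mul {f g : MvPolynomial (Fin 3) K} (hg : g ≠ 0)
    (hfg : IsRelPrime f g) (T : Finset (K × K × K))
    (hT : Set.InjOn (fun t : K × K × K => t.2.2) T)
    (hfT : ∀ t ∈ T, lineEval t f = 0) (hgT : ∀ t ∈ T, lineEval t g = 0) :
    T.card ≤ f.totalDegree * g.totalDegree := by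
  classical
  set d := f.totalDegree with hd
  set e := g.totalDegree with he
  set N := T.card with hN
  obtain ⟨r, hr⟩ : ∃ r : ℕ, r = N ^ 2 + d + e + d * e := ⟨_, rfl⟩
  obtain ⟨a, ha⟩ : ∃ a : ℕ, a + d + e = r + N := ⟨r + N - d - e, by lia⟩
  -- polynomials in `a + e`, `a + d`, `a` and `a + d + e`
  let P := fun n : ℕ => restrictTotalDegree (Fin 3) K n
  let Y : Polynomial K →ₐ[K] MvPolynomial (Fin 3) K := Polynomial.aeval (X 1)
  let S : K × K × K → MvPolynomial (Fin 3) K := fun t => ∏ s ∈ T.erase t, (X 0 - C s.2.2)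
  let Φ : (P (a + e) × P (a + d)) × (T → Polynomial.degreeLT K (r + 1)) →ₗ[K]
      MvPolynomial (Fin 3) K :=
    LinearMap.coprod
      (LinearMap.coprod ((LinearMap.mulLeft K f).comp (P (a + e)).subtype)
        ((LinearMap.mulLeft K g).comp (P (a + d)).subtype))
      (∑ t : T, (LinearMap.mulLeft K (S t)).comp
        (Y.toLinearMap.comp ((Polynomial.degreeLT K (r + 1)).subtype.comp (LinearMap.proj t))))
  have hΦ : ∀ u v w, Φ ((u, v), w) = f * u + g * v + ∑ t : T, S t * Y (w t) := by
    intro u v w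
    simp [Φ, LinearMap.sum_apply]
  have hlY : ∀ t, ∀ q : Polynomial K, lineEval t (Y q) = q := by
    intro t q
    have : lineEval t (Y q) = Polynomial.aeval (lineEval t (X 1)) q :=
      (Polynomial.aeval_algHom_apply _ _ _).symm
    rw [this]
    simp [lineEval]
  have hlS : ∀ t ∈ T, ∀ s ∈ T, s ≠ t → lineEval t (S s) = 0 := by
    intro t ht s hs hst
    simp only [S, map_prod]
    refine Finset.prod_eq_zero (i := t) (by simp [ht, hst.symm]) ?_
    simp [lineEval]
  have hlS' : ∀ t ∈ T, lineEval t (S t) ≠ 0 := by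
    intro t ht
    simp only [S, map_prod]
    rw [Finset.prod_ne_zero_iff]
    intro s hs
    have : lineEval t (X 0 - C s.2.2) = Polynomial.C (t.2.2 - s.2.2) := by
      simp [lineEval]
    rw [this, Ne, Polynomial.C_eq_zero, sub_eq_zero]
    intro h
    exact (Finset.mem_erase.mp hs).1 (hT (Finset.mem_of_mem_erase hs) ht h.symm)
  have hSdeg : ∀ t ∈ T, (S t).totalDegree + 1 ≤ N := by
    intro t ht
    have h1 : (S t).totalDegree ≤ ∑ s ∈ T.erase t, 1 := by
      refine (totalDegree_finsetProd _ _).trans (Finset.sum_le_sum fun s _ => ?_)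
      exact (totalDegree_sub _ _).trans (by simp)
    have h2 := Finset.card_erase_add_one ht
    simp at h1
    lia
  have hYdeg : ∀ q ∈ Polynomial.degreeLT K (r + 1), (Y q).totalDegree ≤ r := by
    intro q hq
    simp only [Y]
    rw [Polynomial.aeval_eq_sum_range]
    refine (totalDegree_finsetSum _ _).trans (Finset.sup_le fun i hi => ?_)
    refine (totalDegree_smul_le _ _).trans ?_
    rw [totalDegree_X_pow]
    rw [Polynomial.mem_degreeLT] at hq
    have h3 : q.natDegree < r + 1 := by
      by_cases hq0 : q = 0
      · simp [hq0]
      · exact (Polynomial.natDegree_lt_iff_degree_lt hq0).2 hq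
    simp at hi
    lia
  -- the kernel
  let Ψ : P a →ₗ[K] (P (a + e) × P (a + d)) × (T → Polynomial.degreeLT K (r + 1)) :=
    LinearMap.inl K _ _ ∘ₗ LinearMap.prod
      (LinearMap.codRestrict _ ((LinearMap.mulLeft K g).comp (P a).subtype) (by
        intro w
        have := (mem_restrictTotalDegree _ _ _).1 w.2
        refine (mem_restrictTotalDegree _ _ _).2 ((totalDegree_mul _ _).trans ?_)
        simp; lia))
      (LinearMap.codRestrict _ ((LinearMap.mulLeft K (-f)).comp (P a).subtype) (by
        intro w
        have := (mem_restrictTotalDegree _ _ _).1 w.2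
        refine (mem_restrictTotalDegree _ _ _).2 ((totalDegree_mul _ _).trans ?_)
        simp; lia))
  have hker : LinearMap.ker Φ ≤ LinearMap.range Ψ := by
    rintro ⟨⟨u, v⟩, w⟩ h
    rw [LinearMap.mem_ker, hΦ] at h
    have hw : w = 0 := by
      funext t
      have h1 := congrArg (lineEval t.1) h
      rw [map_add, map_add, map_mul, map_mul, hfT _ t.2, hgT _ t.2, map_sum,
        Finset.sum_eq_single t] at h1
      · simpa [hlY, hlS' t.1 t.2] using h1
      · intro s _ hst
        rw [map_mul, hlS _ t.2 _ s.2 (fun h => hst (Subtype.ext h)), zero_mul]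
      · simp
    subst hw
    simp only [Pi.zero_apply, Submodule.coe_zero, map_zero, mul_zero, Finset.sum_const_zero,
      add_zero] at h
    have hdvd : g ∣ u.1 := by
      refine IsRelPrime.dvd_of_dvd_mul_left hfg.symm (z := u.1) ⟨-v.1, ?_⟩
      linear_combination h
    obtain ⟨w, hw⟩ := hdvd
    have hv : v.1 = -f * w := by
      apply mul_left_cancel₀ hg
      rw [hw] at h
      linear_combination h
    have hwP : w ∈ P a := by
      refine (mem_restrictTotalDegree _ _ _).2 ?_
      by_cases hw0 : w = 0
      · simp [hw0]
      · have h1 := (mem_restrictTotalDegree _ _ _).1 u.2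
        rw [hw, totalDegree_mul_of_isDomain hg hw0] at h1
        lia
    refine ⟨⟨w, hwP⟩, ?_⟩
    refine Prod.ext (Prod.ext (Subtype.ext ?_) (Subtype.ext ?_)) ?_
    · exact hw.symm
    · exact hv.symm
    · rfl
  have hrange : LinearMap.range Φ ≤ P (a + d + e) := by
    rintro _ ⟨⟨⟨u, v⟩, w⟩, rfl⟩
    rw [hΦ]
    have hu := (mem_restrictTotalDegree _ _ _).1 u.2
    have hv := (mem_restrictTotalDegree _ _ _).1 v.2
    refine add_mem (add_mem ?_ ?_) (sum_mem fun t _ => ?_)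
    · refine (mem_restrictTotalDegree _ _ _).2 ((totalDegree_mul _ _).trans ?_); lia
    · refine (mem_restrictTotalDegree _ _ _).2 ((totalDegree_mul _ _).trans ?_); lia
    · refine (mem_restrictTotalDegree _ _ _).2 ((totalDegree_mul _ _).trans ?_)
      have := hSdeg t t.2
      have := hYdeg (w t) (w t).2
      lia
  have hrn := LinearMap.finrank_range_add_finrank_ker Φ
  have h1 : Module.finrank K (LinearMap.range Φ) ≤ (a + d + e + 3).choose 3 := by
    rw [← finrank_restrictTotalDegree_fin_three (K := K)]
    exact Submodule.finrank_mono hrange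
  have h2 : Module.finrank K (LinearMap.ker Φ) ≤ (a + 3).choose 3 := by
    rw [← finrank_restrictTotalDegree_fin_three (K := K)]
    exact (Submodule.finrank_mono hker).trans (LinearMap.finrank_range_le _)
  have h3 : Module.finrank K ((P (a + e) × P (a + d)) × (T → Polynomial.degreeLT K (r + 1))) =
      (a + e + 3).choose 3 + (a + d + 3).choose 3 + N * (r + 1) := by
    have hdl : Module.finrank K (Polynomial.degreeLT K (r + 1)) = r + 1 := by
      rw [(Polynomial.degreeLTEquiv K (r + 1)).finrank_eq]; simp
    rw [Module.finrank_prod, Module.finrank_prod, Module.finrank_pi_fintype,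
      finrank_restrictTotalDegree_fin_three, finrank_restrictTotalDegree_fin_three]
    simp [hdl, hN]
  have h4 : (a + e + 3).choose 3 + (a + d + 3).choose 3 + N * (r + 1) ≤
      (a + d + e + 3).choose 3 + (a + 3).choose 3 := by lia
  exact le_mul_of_choose_three_le ha hr h4

end Bezout

section Surface

open MvPolynomial

variable {K : Type*} [Field K]

theorem exists_totalDegree_le_lineEval'_eq_zero {d : ℕ} (S : Finset (K × K × K))
    (hS : S.card * (d + 1) < (d + 3).choose 3) :
    ∃ f : MvPolynomial (Fin 3) K, f ≠ 0 ∧ f.totalDegree ≤ d ∧ ∀ t ∈ S, lineEval' t f = 0 := by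
  let Φ : restrictTotalDegree (Fin 3) K d →ₗ[K] (S → Polynomial.degreeLT K (d + 1)) :=
    LinearMap.pi fun t => LinearMap.codRestrict _
      ((lineEval' t.1).toLinearMap.comp (restrictTotalDegree (Fin 3) K d).subtype) (by
        intro f
        have h1 := (mem_restrictTotalDegree _ _ _).1 f.2
        have h2 := natDegree_lineEval'_le t.1 f.1
        rw [Polynomial.mem_degreeLT]
        exact lt_of_le_of_lt Polynomial.degree_le_natDegree (by
          simp only [LinearMap.comp_apply, Submodule.subtype_apply, AlgHom.toLinearMap_apply]
          exact_mod_cast (by lia)))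
  have hlt : Module.finrank K (S → Polynomial.degreeLT K (d + 1)) <
      Module.finrank K (restrictTotalDegree (Fin 3) K d) := by
    have hdl : Module.finrank K (Polynomial.degreeLT K (d + 1)) = d + 1 := by
      rw [(Polynomial.degreeLTEquiv K (d + 1)).finrank_eq]; simp
    rw [finrank_restrictTotalDegree_fin_three, Module.finrank_pi_fintype]
    simpa [hdl] using hS
  obtain ⟨f, hf, hf0⟩ := (Submodule.ne_bot_iff _).1 (LinearMap.ker_ne_bot_of_finrank_lt (f := Φ) hlt)
  refine ⟨f.1, by simpa using hf0, (mem_restrictTotalDegree _ _ _).1 f.2, fun t ht => ?_⟩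
  exact congrArg Subtype.val (congrFun (LinearMap.mem_ker.1 hf) ⟨t, ht⟩)

/-- The line of `s` in the plane `y = s.2.2` meets the line of `t` in the plane `x = t.2.2`. -/
def Meets (s t : K × K × K) : Prop :=
  s.1 * t.2.2 + s.2.1 = t.1 * s.2.2 + t.2.1

theorem Meets.symm {s t : K × K × K} (h : Meets s t) : Meets t s := Eq.symm h

theorem eval_lineEval (t : K × K × K) (b : K) (f : MvPolynomial (Fin 3) K) :
    (lineEval t f).eval b = aeval ![t.2.2, b, t.1 * b + t.2.1] f := by
  rw [← Polynomial.coe_evalRingHom, ← Polynomial.coe_aeval_eq_evalRingHom, lineEval,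
    RingHom.coe_coe, ← AlgHom.comp_apply, comp_aeval]
  congr 2
  funext i
  fin_cases i <;> simp

theorem eval_lineEval' (t : K × K × K) (b : K) (f : MvPolynomial (Fin 3) K) :
    (lineEval' t f).eval b = aeval ![b, t.2.2, t.1 * b + t.2.1] f := by
  rw [← Polynomial.coe_evalRingHom, ← Polynomial.coe_aeval_eq_evalRingHom, lineEval',
    RingHom.coe_coe, ← AlgHom.comp_apply, comp_aeval]
  congr 2
  funext i
  fin_cases i <;> simp

theorem Meets.eval_eq {s t : K × K × K} (h : Meets s t) (f : MvPolynomial (Fin 3) K) :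
    (lineEval t f).eval s.2.2 = (lineEval' s f).eval t.2.2 := by
  rw [eval_lineEval, eval_lineEval', ← h]

/-- A polynomial vanishing on more than `deg f` transversal lines vanishes on the line. -/
theorem lineEval_eq_zero_of_card {f : MvPolynomial (Fin 3) K} {t : K × K × K}
    (S : Finset (K × K × K)) (hS : Set.InjOn (fun s : K × K × K => s.2.2) S)
    (hSt : ∀ s ∈ S, Meets s t ∧ lineEval' s f = 0) (hcard : f.totalDegree < S.card) :
    lineEval t f = 0 := by
  classical
  refine Polynomial.eq_zero_of_natDegree_lt_card_of_eval_eq_zero' _ (S.image fun s => s.2.2) ?_ ?_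
  · intro b hb
    obtain ⟨s, hs, rfl⟩ := Finset.mem_image.1 hb
    rw [(hSt s hs).1.eval_eq, (hSt s hs).2, Polynomial.eval_zero]
  · rw [Finset.card_image_of_injOn hS]
    exact (natDegree_lineEval_le t f).trans_lt hcard

theorem lineEval'_eq_zero_of_card {f : MvPolynomial (Fin 3) K} {s : K × K × K}
    (T : Finset (K × K × K)) (hT : Set.InjOn (fun s : K × K × K => s.2.2) T)
    (hTs : ∀ t ∈ T, Meets s t ∧ lineEval t f = 0) (hcard : f.totalDegree < T.card) :
    lineEval' s f = 0 := by
  classical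
  refine Polynomial.eq_zero_of_natDegree_lt_card_of_eval_eq_zero' _ (T.image fun s => s.2.2) ?_ ?_
  · intro b hb
    obtain ⟨t, ht, rfl⟩ := Finset.mem_image.1 hb
    rw [← (hTs t ht).1.eval_eq, (hTs t ht).2, Polynomial.eval_zero]
  · rw [Finset.card_image_of_injOn hT]
    exact (natDegree_lineEval'_le s f).trans_lt hcard

theorem totalDegree_pderiv_le (i : Fin 3) (f : MvPolynomial (Fin 3) K) :
    (pderiv i f).totalDegree ≤ f.totalDegree - 1 := by
  rw [totalDegree, Finset.sup_le_iff]
  intro m hm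
  rw [mem_support_iff, coeff_pderiv] at hm
  have h1 : m + Finsupp.single i 1 ∈ f.support := by
    rw [mem_support_iff]
    exact left_ne_zero_of_mul hm
  have h2 := le_totalDegree h1
  rw [Finsupp.sum_add_index' (by simp) (by simp)] at h2
  simp at h2
  lia

variable {p : ℕ} [CharP K p]

/-- In low degree, a polynomial with vanishing `z`-derivative does not involve `z`. -/
theorem apply_two_eq_zero_of_pderiv_eq_zero {q : MvPolynomial (Fin 3) K} (hq : pderiv 2 q = 0)
    (hdeg : q.totalDegree < p) {m : Fin 3 →₀ ℕ} (hm : m ∈ q.support) : m 2 = 0 := by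
  by_contra h
  have h1 := coeff_pderiv (i := (2 : Fin 3)) q (m - Finsupp.single 2 1)
  have h2 : m - Finsupp.single 2 1 + Finsupp.single 2 1 = m :=
    tsub_add_cancel_of_le (by simpa [Nat.one_le_iff_ne_zero] using h)
  rw [hq, h2, coeff_zero] at h1
  have h3 := (mul_eq_zero.1 h1.symm).resolve_left (mem_support_iff.1 hm)
  have h4 : ((m 2 : ℕ) : K) = 0 := by
    rw [← h3]
    have : ((m - Finsupp.single 2 1 : Fin 3 →₀ ℕ)) 2 + 1 = m 2 := by simp; lia
    rw [← this]; push_cast; rfl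
  rw [CharP.cast_eq_zero_iff K p] at h4
  have h5 : m 2 ≤ q.totalDegree := (Finsupp.le_degree 2 m).trans (le_totalDegree hm)
  exact absurd (Nat.le_of_dvd (Nat.pos_of_ne_zero h) h4) (by lia)

theorem card_lines_le_of_pderiv_eq_zero {q : MvPolynomial (Fin 3) K} (hq0 : q ≠ 0)
    (hq : pderiv 2 q = 0) (hdeg : q.totalDegree < p) (T : Finset (K × K × K))
    (hT : Set.InjOn (fun t : K × K × K => t.2.2) T) (hqT : ∀ t ∈ T, lineEval t q = 0) :
    T.card ≤ q.totalDegree := by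
  classical
  have hX : ¬ (X 2 : MvPolynomial (Fin 3) K) ∣ q := by
    rintro ⟨r, rfl⟩
    obtain ⟨m, hm⟩ := support_nonempty.2 hq0
    have h1 := apply_two_eq_zero_of_pderiv_eq_zero hq hdeg hm
    rw [mem_support_iff, coeff_X_mul', if_neg (by simpa using h1)] at hm
    exact hm rfl
  have hrel : IsRelPrime q (X 2) :=
    ((X_prime : Prime (X 2 : MvPolynomial (Fin 3) K)).irreducible.isRelPrime_iff_not_dvd.2 hX).symm
  have hz : ∀ t : K × K × K, lineEval (0, 0, t.2.2) q = lineEval t q := by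
    intro t
    rw [lineEval, lineEval, aeval_def, aeval_def, eval₂_eq', eval₂_eq']
    refine Finset.sum_congr rfl fun m hm => ?_
    simp [Fin.prod_univ_three, apply_two_eq_zero_of_pderiv_eq_zero hq hdeg hm]
  have hinj : Set.InjOn (fun t : K × K × K => ((0 : K), (0 : K), t.2.2)) T := by
    intro s hs t ht hst
    have h : ((0 : K), (0 : K), s.2.2) = (0, 0, t.2.2) := hst
    exact hT hs ht (by simpa using h)
  have := card_lines_le_mul (X_ne_zero 2) hrel
    (T.image fun t : K × K × K => ((0 : K), (0 : K), t.2.2)) (by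
      intro s hs t ht hst
      simp only [Finset.coe_image, Set.mem_image] at hs ht
      obtain ⟨s', _, rfl⟩ := hs
      obtain ⟨t', _, rfl⟩ := ht
      simpa using hst) (by
      intro t ht
      obtain ⟨s, hs, rfl⟩ := Finset.mem_image.1 ht
      rw [hz, hqT s hs]) (by
      intro t ht
      obtain ⟨s, hs, rfl⟩ := Finset.mem_image.1 ht
      simp [lineEval])
  rwa [Finset.card_image_of_injOn hinj, totalDegree_X, mul_one] at this

theorem card_lines'_le_of_pderiv_eq_zero {q : MvPolynomial (Fin 3) K} (hq0 : q ≠ 0)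
    (hq : pderiv 2 q = 0) (hdeg : q.totalDegree < p) (T : Finset (K × K × K))
    (hT : Set.InjOn (fun t : K × K × K => t.2.2) T) (hqT : ∀ t ∈ T, lineEval' t q = 0) :
    T.card ≤ q.totalDegree := by
  have hle := totalDegree_rename_le (Equiv.swap (0 : Fin 3) 1) q
  have hinj := (Equiv.swap (0 : Fin 3) 1).injective
  refine (card_lines_le_of_pderiv_eq_zero (q := rename (Equiv.swap 0 1) q) (p := p) ?_ ?_ ?_ T hT
    fun t ht => ?_).trans hle
  · exact (map_ne_zero_iff _ (rename_injective _ hinj)).2 hq0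
  · have := pderiv_rename hinj 2 q
    rw [show (Equiv.swap (0 : Fin 3) 1) 2 = 2 by decide] at this
    rw [this, hq, map_zero]
  · exact hle.trans_lt hdeg
  · rw [← lineEval'_eq, hqT t ht]

/-- After dropping few lines from two families covered by a surface, the equation of the surface can
be taken relatively prime to its `z`-derivative. -/
theorem exists_isRelPrime_pderiv (X₁ X₂ : Finset (K × K × K))
    (h₁ : Set.InjOn (fun t : K × K × K => t.2.2) X₁)
    (h₂ : Set.InjOn (fun t : K × K × K => t.2.2) X₂) [DecidableEq K] (n : ℕ) (hn : n < p)
    (f : MvPolynomial (Fin 3) K) (hf : f ≠ 0) (hfn : f.totalDegree ≤ n) :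
    ∃ g : MvPolynomial (Fin 3) K, g ≠ 0 ∧ g.totalDegree ≤ n ∧ IsRelPrime g (pderiv 2 g) ∧
      (X₁.filter fun t => lineEval' t f = 0 ∧ lineEval' t g ≠ 0).card ≤ n ∧
      (X₂.filter fun t => lineEval t f = 0 ∧ lineEval t g ≠ 0).card ≤ n := by
  classical
  induction n using Nat.strong_induction_on generalizing f with
  | _ n ih =>
  by_cases hrel : IsRelPrime f (pderiv 2 f)
  · refine ⟨f, hf, hfn, hrel, ?_, ?_⟩ <;>
    · rw [Finset.filter_false_of_mem (by tauto)]
      simp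
  obtain ⟨q, hq, ⟨r, rfl⟩, hqf⟩ :
      ∃ q : MvPolynomial (Fin 3) K, Irreducible q ∧ q ∣ f ∧ q ∣ pderiv 2 f := by
    rw [IsRelPrime] at hrel
    push Not at hrel
    obtain ⟨a, ha1, ha2, ha⟩ := hrel
    obtain ⟨q, hq, hqa⟩ := WfDvdMonoid.exists_irreducible_factor ha
      (fun h => hf (by rw [h] at ha1; exact zero_dvd_iff.1 ha1))
    exact ⟨q, hq, hqa.trans ha1, hqa.trans ha2⟩
  have hr0 : r ≠ 0 := right_ne_zero_of_mul hf
  have hqdeg : q.totalDegree ≠ 0 := by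
    intro h
    rw [totalDegree_eq_zero_iff_eq_C] at h
    refine hq.not_isUnit ?_
    rw [h]
    refine IsUnit.map C (isUnit_iff_ne_zero.2 fun h0 => hq.ne_zero ?_)
    rw [h, h0, map_zero]
  rw [totalDegree_mul_of_isDomain hq.ne_zero hr0] at hfn
  obtain ⟨g, hg0, hgn, hgrel, hg1, hg2⟩ :=
    ih (n - q.totalDegree) (by lia) (by lia) r hr0 (by lia)
  have key : ((X₁.filter fun t => lineEval' t q = 0 ∧ lineEval' t r ≠ 0).card ≤ q.totalDegree) ∧
      ((X₂.filter fun t => lineEval t q = 0 ∧ lineEval t r ≠ 0).card ≤ q.totalDegree) := by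
    by_cases hqz : pderiv 2 q = 0
    · constructor
      · refine card_lines'_le_of_pderiv_eq_zero (p := p) hq.ne_zero hqz (by lia) _
          (h₁.mono (Finset.coe_subset.2 (Finset.filter_subset _ _))) fun t ht => ?_
        exact (Finset.mem_filter.1 ht).2.1
      · refine card_lines_le_of_pderiv_eq_zero (p := p) hq.ne_zero hqz (by lia) _
          (h₂.mono (Finset.coe_subset.2 (Finset.filter_subset _ _))) fun t ht => ?_
        exact (Finset.mem_filter.1 ht).2.1
    · have hqr : q ∣ r := by
        rw [pderiv_mul, dvd_add_left (dvd_mul_right _ _)] at hqf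
        refine (hq.prime.dvd_or_dvd hqf).resolve_left fun h => ?_
        have h1 := totalDegree_le_of_dvd_of_isDomain h hqz
        have h2 := totalDegree_pderiv_le 2 q
        lia
      obtain ⟨u, rfl⟩ := hqr
      constructor <;>
      · rw [Finset.filter_false_of_mem (by
          intro t _ h
          refine h.2 ?_
          rw [map_mul, h.1, zero_mul])]
        simp
  refine ⟨g, hg0, by lia, hgrel, ?_, ?_⟩
  · have : (X₁.filter fun t => lineEval' t (q * r) = 0 ∧ lineEval' t g ≠ 0) ⊆
        (X₁.filter fun t => lineEval' t r = 0 ∧ lineEval' t g ≠ 0) ∪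
        (X₁.filter fun t => lineEval' t q = 0 ∧ lineEval' t r ≠ 0) := by
      intro t ht
      simp only [Finset.mem_filter, Finset.mem_union, map_mul, mul_eq_zero] at ht ⊢
      tauto
    have := (Finset.card_le_card this).trans (Finset.card_union_le _ _)
    have := key.1
    lia
  · have : (X₂.filter fun t => lineEval t (q * r) = 0 ∧ lineEval t g ≠ 0) ⊆
        (X₂.filter fun t => lineEval t r = 0 ∧ lineEval t g ≠ 0) ∪
        (X₂.filter fun t => lineEval t q = 0 ∧ lineEval t r ≠ 0) := by
      intro t ht
      simp only [Finset.mem_filter, Finset.mem_union, map_mul, mul_eq_zero] at ht ⊢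
      tauto
    have := (Finset.card_le_card this).trans (Finset.card_union_le _ _)
    have := key.2
    lia

end Surface

section Wronskian

open Polynomial

variable {K : Type*} [Field K] {p : ℕ} [CharP K p]

theorem exists_eq_C_of_derivative_eq_zero {a : K[X]} (ha : derivative a = 0)
    (hap : a.natDegree < p) : ∃ c, a = C c := by
  refine ⟨_, eq_C_of_natDegree_eq_zero (p := a) ?_⟩
  by_contra h0
  have h1 := congrArg (fun q : K[X] => q.coeff (a.natDegree - 1)) ha
  simp only [coeff_derivative, coeff_zero] at h1
  have h2 : a.natDegree - 1 + 1 = a.natDegree := by lia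
  have h3 : ((a.natDegree - 1 : ℕ) : K) + 1 = (a.natDegree : ℕ) := by rw [← h2]; push_cast; simp
  rw [h2, h3, mul_eq_zero, CharP.cast_eq_zero_iff K p, coeff_natDegree, leadingCoeff_eq_zero] at h1
  rcases h1 with rfl | h1
  · simp at h0
  · exact absurd (Nat.le_of_dvd (Nat.pos_of_ne_zero h0) h1) (by lia)

/-- In low degree, polynomials with vanishing Wronskian are proportional. -/
theorem exists_eq_C_mul_of_derivative_mul_eq {a b : K[X]} (hb : b ≠ 0) (ha : a.natDegree < p)
    (hbp : b.natDegree < p) (h : derivative a * b = a * derivative b) : ∃ c, a = C c * b := by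
  obtain ⟨a', b', g, hrel, rfl, rfl⟩ := UniqueFactorizationMonoid.exists_reduced_factors' a b hb
  have hg : g ≠ 0 := left_ne_zero_of_mul hb
  have hb' : b' ≠ 0 := right_ne_zero_of_mul hb
  have hw : wronskian a' b' = 0 := by
    refine (mul_eq_zero.1 (?_ : g ^ 2 * wronskian a' b' = 0)).resolve_left (pow_ne_zero 2 hg)
    rw [derivative_mul, derivative_mul] at h
    rw [wronskian]
    linear_combination -h
  obtain ⟨h1, h2⟩ := (isRelPrime_iff_isCoprime.1 hrel).wronskian_eq_zero_iff.1 hw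
  rw [natDegree_mul hg hb'] at hbp
  obtain ⟨β, rfl⟩ := exists_eq_C_of_derivative_eq_zero h2 (p := p) (by lia)
  have hβ : β ≠ 0 := fun h => hb' (by rw [h, C_0])
  obtain ⟨α, rfl⟩ : ∃ c, a' = C c := by
    by_cases ha' : a' = 0
    · exact ⟨0, by rw [ha', C_0]⟩
    · rw [natDegree_mul hg ha'] at ha
      exact exists_eq_C_of_derivative_eq_zero h1 (p := p) (by lia)
  refine ⟨α / β, ?_⟩
  rw [mul_left_comm, ← C_mul, div_mul_cancel₀ _ hβ]

/-- A polynomial solution of the differential equation of linear fractional maps. -/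
theorem exists_linear_of_schwarzian {u w : K[X]} {d : ℕ} (hd : 2 * d < p) (hw : w ≠ 0)
    (hud : u.natDegree + 1 ≤ d) (hwd : w.natDegree + 1 ≤ d)
    (h : w ^ 2 * derivative (derivative u) - u * w * derivative (derivative w) -
      2 * w * derivative w * derivative u + 2 * u * derivative w ^ 2 = 0) :
    ∃ e c, u = (C e * X + C c) * w := by
  have hdu := natDegree_derivative_le u
  have hdw := natDegree_derivative_le w
  obtain ⟨e, he⟩ := exists_eq_C_mul_of_derivative_mul_eq (p := p)
    (a := derivative u * w - u * derivative w) (b := w ^ 2) (pow_ne_zero 2 hw) (by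
      have h1 := natDegree_mul_le (p := derivative u) (q := w)
      have h2 := natDegree_mul_le (p := u) (q := derivative w)
      have h3 := natDegree_sub_le (derivative u * w) (u * derivative w)
      lia) (by
      have := natDegree_pow_le (p := w) (n := 2)
      lia) (by
      simp only [derivative_sub, derivative_mul, derivative_pow]
      simp only [Nat.cast_ofNat, map_ofNat]
      norm_num
      linear_combination w * h)
  obtain ⟨c, hc⟩ := exists_eq_C_mul_of_derivative_mul_eq (p := p)
    (a := u - C e * X * w) (b := w) hw (by
      have h1 := natDegree_mul_le (p := C e * X) (q := w)
      have h2 : (C e * X).natDegree ≤ 1 := natDegree_mul_le.trans (by simp)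
      have h3 := natDegree_sub_le u (C e * X * w)
      lia) (by lia) (by
      simp only [derivative_sub, derivative_mul, derivative_C, derivative_X]
      linear_combination he)
  exact ⟨e, c, by linear_combination hc⟩

end Wronskian

section Ruled

open MvPolynomial

variable {K : Type*} [Field K]

theorem pderiv_comm_apply (i j : Fin 3) (f : MvPolynomial (Fin 3) K) :
    pderiv i (pderiv j f) = pderiv j (pderiv i f) := by
  rcases eq_or_ne i j with rfl | hij
  · rfl
  · ext m
    simp only [coeff_pderiv, Finsupp.add_apply, Finsupp.single_eq_of_ne hij,
      Finsupp.single_eq_of_ne hij.symm, add_right_comm m]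
    push_cast
    ring

theorem derivative_lineEval (t : K × K × K) (q : MvPolynomial (Fin 3) K) :
    Polynomial.derivative (lineEval t q) =
      lineEval t (pderiv 1 q) + Polynomial.C t.1 * lineEval t (pderiv 2 q) := by
  induction q using MvPolynomial.induction_on with
  | C a => simp [lineEval]
  | add p q hp hq => simp only [map_add, hp, hq]; ring
  | mul_X p i hp =>
    simp only [map_mul, Polynomial.derivative_mul, hp, pderiv_mul, map_add]
    fin_cases i <;> simp [lineEval, pderiv_X] <;> ring

/-- This vanishes on the lines `x = const` through which the surface `f = 0` passes. -/
noncomputable def flecnode (f : MvPolynomial (Fin 3) K) : MvPolynomial (Fin 3) K :=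
  pderiv 1 (pderiv 1 f) * pderiv 2 f ^ 2 -
    2 * pderiv 1 (pderiv 2 f) * pderiv 1 f * pderiv 2 f +
    pderiv 2 (pderiv 2 f) * pderiv 1 f ^ 2

theorem totalDegree_flecnode_le (f : MvPolynomial (Fin 3) K) :
    (flecnode f).totalDegree ≤ 3 * f.totalDegree := by
  have h1 := totalDegree_pderiv_le 1 f
  have h2 := totalDegree_pderiv_le 2 f
  have h11 := totalDegree_pderiv_le 1 (pderiv 1 f)
  have h12 := totalDegree_pderiv_le 1 (pderiv 2 f)
  have h22 := totalDegree_pderiv_le 2 (pderiv 2 f)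
  refine (totalDegree_add _ _).trans (max_le ((totalDegree_sub _ _).trans (max_le ?_ ?_)) ?_)
  · have := totalDegree_mul (pderiv 1 (pderiv 1 f)) (pderiv 2 f ^ 2)
    have := totalDegree_pow (pderiv 2 f) 2
    lia
  · have h0 : (2 : MvPolynomial (Fin 3) K).totalDegree = 0 := by
      rw [← map_ofNat (C (σ := Fin 3) (R := K)) 2, totalDegree_C]
    have := totalDegree_mul (2 * pderiv 1 (pderiv 2 f) * pderiv 1 f) (pderiv 2 f)
    have := totalDegree_mul (2 * pderiv 1 (pderiv 2 f)) (pderiv 1 f)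
    have := totalDegree_mul 2 (pderiv 1 (pderiv 2 f))
    lia
  · have := totalDegree_mul (pderiv 2 (pderiv 2 f)) (pderiv 1 f ^ 2)
    have := totalDegree_pow (pderiv 1 f) 2
    lia

section

variable {t : K × K × K} {f : MvPolynomial (Fin 3) K}

theorem lineEval_pderiv_one (h : lineEval t f = 0) :
    lineEval t (pderiv 1 f) = -Polynomial.C t.1 * lineEval t (pderiv 2 f) := by
  have := derivative_lineEval t f
  rw [h, map_zero] at this
  linear_combination -this

theorem lineEval_pderiv_one_one (h : lineEval t f = 0) :
    lineEval t (pderiv 1 (pderiv 1 f)) + Polynomial.C t.1 * lineEval t (pderiv 1 (pderiv 2 f)) =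
      -Polynomial.C t.1 * Polynomial.derivative (lineEval t (pderiv 2 f)) := by
  have := derivative_lineEval t (pderiv 1 f)
  rw [lineEval_pderiv_one h, pderiv_comm_apply 2 1] at this
  simp only [neg_mul, Polynomial.derivative_neg, Polynomial.derivative_mul,
    Polynomial.derivative_C] at this
  linear_combination -this

theorem lineEval_flecnode (h : lineEval t f = 0) : lineEval t (flecnode f) = 0 := by
  simp only [flecnode, map_add, map_sub, map_mul, map_pow, map_ofNat]
  have h1 := lineEval_pderiv_one h
  have h2 := lineEval_pderiv_one_one h
  have h3 := derivative_lineEval t (pderiv 2 f)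
  rw [h3] at h2
  rw [h1]
  linear_combination lineEval t (pderiv 2 f) ^ 2 * h2

theorem lineEval_pderiv_flecnode (h : lineEval t f = 0)
    (hG : lineEval t (pderiv 2 f) * lineEval t (pderiv 0 (flecnode f)) =
      lineEval t (pderiv 0 f) * lineEval t (pderiv 2 (flecnode f)))
    (hw : lineEval t (pderiv 2 f) ≠ 0) :
    lineEval t (pderiv 2 f) ^ 2 *
        Polynomial.derivative (Polynomial.derivative (-lineEval t (pderiv 0 f))) -
      -lineEval t (pderiv 0 f) * lineEval t (pderiv 2 f) *
        Polynomial.derivative (Polynomial.derivative (lineEval t (pderiv 2 f))) -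
      2 * lineEval t (pderiv 2 f) * Polynomial.derivative (lineEval t (pderiv 2 f)) *
        Polynomial.derivative (-lineEval t (pderiv 0 f)) +
      2 * -lineEval t (pderiv 0 f) * Polynomial.derivative (lineEval t (pderiv 2 f)) ^ 2 = 0 := by
  have key : ∀ i : Fin 3, lineEval t (pderiv i (flecnode f)) =
      lineEval t (pderiv 2 f) ^ 2 *
        Polynomial.derivative (Polynomial.derivative (lineEval t (pderiv i f))) -
      2 * lineEval t (pderiv 2 f) * Polynomial.derivative (lineEval t (pderiv 2 f)) *
        Polynomial.derivative (lineEval t (pderiv i f)) := by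
    intro i
    have h1 := lineEval_pderiv_one h
    have h2 := lineEval_pderiv_one_one h
    have h3 := derivative_lineEval t (pderiv 2 f)
    have h4 : pderiv i (2 : MvPolynomial (Fin 3) K) = 0 := by
      rw [← map_ofNat (C (σ := Fin 3) (R := K)) 2, pderiv_C]
    have h5 := derivative_lineEval t (pderiv i f)
    have h6 : Polynomial.derivative (Polynomial.derivative (lineEval t (pderiv i f))) =
        lineEval t (pderiv i (pderiv 1 (pderiv 1 f))) +
          2 * Polynomial.C t.1 * lineEval t (pderiv i (pderiv 1 (pderiv 2 f))) +
          Polynomial.C t.1 ^ 2 * lineEval t (pderiv i (pderiv 2 (pderiv 2 f))) := by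
      rw [h5]
      simp only [map_add, Polynomial.derivative_mul, Polynomial.derivative_C, derivative_lineEval]
      rw [pderiv_comm_apply i 1, pderiv_comm_apply i 1, pderiv_comm_apply i 2,
        pderiv_comm_apply i 1, pderiv_comm_apply i 2, pderiv_comm_apply 2 1 (pderiv i f)]
      ring
    rw [h6, h5]
    simp only [flecnode, map_add, map_sub, map_mul, pderiv_mul, pderiv_pow, h4, map_ofNat,
      map_pow, pow_one, map_zero, Nat.cast_ofNat, zero_mul, Nat.add_one_sub_one]
    rw [h1]
    rw [pderiv_comm_apply 1 i f, pderiv_comm_apply 2 i f]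
    generalize lineEval t (pderiv 2 f) = w at *
    linear_combination 2 * w * lineEval t (pderiv i (pderiv 2 f)) * h2 +
      2 * w * lineEval t (pderiv i (pderiv 1 f)) * h3
  refine (mul_eq_zero.1 ?_).resolve_left hw
  rw [key, key] at hG
  simp only [Polynomial.derivative_neg]
  linear_combination -hG

end

/-- A surface contains few lines `x = const` with nonlinear behaviour of its tangent plane. -/
theorem exists_linear_tangent {p : ℕ} [CharP K p] [DecidableEq K] {f : MvPolynomial (Fin 3) K}
    (hf : f ≠ 0) (hrel : IsRelPrime f (pderiv 2 f)) (hp : 2 * f.totalDegree < p)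
    (Y : Finset (K × K × K)) (hY : Set.InjOn (fun t : K × K × K => t.2.2) Y)
    (hfY : ∀ t ∈ Y, lineEval t f = 0) :
    ∃ E ⊆ Y, E.card ≤ 4 * f.totalDegree ^ 2 ∧ ∀ t ∈ Y \ E, lineEval t (pderiv 2 f) ≠ 0 ∧
      ∃ e c, -lineEval t (pderiv 0 f) =
        (Polynomial.C e * Polynomial.X + Polynomial.C c) * lineEval t (pderiv 2 f) := by
  classical
  obtain ⟨h, H, g, hhH, hgh, hgH⟩ :=
    UniqueFactorizationMonoid.exists_reduced_factors f hf (flecnode f)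
  have hh0 : h ≠ 0 := right_ne_zero_of_mul (hgh ▸ hf)
  have hg0 : g ≠ 0 := left_ne_zero_of_mul (hgh ▸ hf)
  have hhdeg : h.totalDegree ≤ f.totalDegree := by
    rw [← hgh, totalDegree_mul_of_isDomain hg0 hh0]; lia
  have hhg : IsRelPrime h g := by
    rintro u ⟨a, rfl⟩ ⟨b, rfl⟩
    refine hrel ⟨b * (u * a), by rw [← hgh]; ring⟩ ?_
    rw [← hgh]
    simp only [pderiv_mul]
    exact ⟨(pderiv 2 u * b + u * pderiv 2 b) * a + b * (pderiv 2 u * a + u * pderiv 2 a), by ring⟩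
  have hhG : IsRelPrime h (flecnode f) := hgH ▸ hhg.mul_right hhH
  have hunit : ∀ q : MvPolynomial (Fin 3) K, IsUnit q → ∀ t, lineEval t q ≠ 0 :=
    fun q hq t => (hq.map (lineEval t)).ne_zero
  have c1 : (Y.filter fun t => lineEval t h = 0).card ≤ 3 * f.totalDegree ^ 2 := by
    by_cases hG : flecnode f = 0
    · rw [Finset.filter_false_of_mem]
      · simp
      · exact fun t _ => hunit h (hhG dvd_rfl (hG ▸ dvd_zero _)) t
    · refine (card_lines_le_mul hG hhG (Y.filter fun t => lineEval t h = 0)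
        (hY.mono (Finset.coe_subset.2 (Finset.filter_subset _ _)))
        (fun t ht => (Finset.mem_filter.1 ht).2)
        (fun t ht => lineEval_flecnode (hfY t (Finset.mem_filter.1 ht).1))).trans ?_
      calc _ ≤ f.totalDegree * (3 * f.totalDegree) :=
            Nat.mul_le_mul hhdeg (totalDegree_flecnode_le f)
        _ = _ := by ring
  have c2 : (Y.filter fun t => lineEval t (pderiv 2 f) = 0).card ≤ f.totalDegree ^ 2 := by
    by_cases hz : pderiv 2 f = 0
    · rw [Finset.filter_false_of_mem]
      · simp
      · exact fun t ht => absurd (hfY t ht) (hunit f (hrel dvd_rfl (hz ▸ dvd_zero _)) t)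
    · refine (card_lines_le_mul hz hrel (Y.filter fun t => lineEval t (pderiv 2 f) = 0)
        (hY.mono (Finset.coe_subset.2 (Finset.filter_subset _ _)))
        (fun t ht => hfY t (Finset.mem_filter.1 ht).1)
        (fun t ht => (Finset.mem_filter.1 ht).2)).trans ?_
      rw [sq]
      exact Nat.mul_le_mul le_rfl ((totalDegree_pderiv_le 2 f).trans (Nat.sub_le _ _))
  refine ⟨Y.filter (fun t => lineEval t h = 0) ∪ Y.filter (fun t => lineEval t (pderiv 2 f) = 0),
    Finset.union_subset (Finset.filter_subset _ _) (Finset.filter_subset _ _),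
    (Finset.card_union_le _ _).trans (by lia), fun t ht => ?_⟩
  simp only [Finset.mem_sdiff, Finset.mem_union, Finset.mem_filter, not_or, not_and] at ht
  obtain ⟨htY, hth, hw⟩ := ht
  have hth := hth htY
  have hw := hw htY
  refine ⟨hw, ?_⟩
  have hgt : lineEval t g = 0 := by
    have := hfY t htY
    rw [← hgh, map_mul] at this
    exact (mul_eq_zero.1 this).resolve_right hth
  have hpf : ∀ i, lineEval t (pderiv i f) = lineEval t (pderiv i g) * lineEval t h := by
    intro i
    rw [← hgh, pderiv_mul, map_add, map_mul, map_mul, hgt]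
    ring
  have hpG : ∀ i, lineEval t (pderiv i (flecnode f)) =
      lineEval t (pderiv i g) * lineEval t H := by
    intro i
    rw [← hgH, pderiv_mul, map_add, map_mul, map_mul, hgt]
    ring
  have hd1 : 0 < f.totalDegree := by
    rw [Nat.pos_iff_ne_zero]
    intro h0
    have h1 := totalDegree_eq_zero_iff_eq_C.1 h0
    refine hunit f ?_ t (hfY t htY)
    rw [h1]
    refine IsUnit.map C (isUnit_iff_ne_zero.2 fun h2 => hf ?_)
    rw [h1, h2, C_0]
  refine exists_linear_of_schwarzian hp hw ?_ ?_
    (lineEval_pderiv_flecnode (hfY t htY) (by rw [hpf, hpf, hpG, hpG]; ring) hw)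
  · have := natDegree_lineEval_le t (pderiv 0 f)
    have := totalDegree_pderiv_le 0 f
    rw [Polynomial.natDegree_neg]
    lia
  · have := natDegree_lineEval_le t (pderiv 2 f)
    have := totalDegree_pderiv_le 2 f
    lia

end Ruled

section Energy

open MvPolynomial

variable {K : Type*} [Field K]

theorem derivative_lineEval' (t : K × K × K) (q : MvPolynomial (Fin 3) K) :
    Polynomial.derivative (lineEval' t q) =
      lineEval' t (pderiv 0 q) + Polynomial.C t.1 * lineEval' t (pderiv 2 q) := by
  induction q using MvPolynomial.induction_on with
  | C a => simp [lineEval']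
  | add p q hp hq => simp only [map_add, hp, hq]; ring
  | mul_X p i hp =>
    simp only [map_mul, Polynomial.derivative_mul, hp, pderiv_mul, map_add]
    fin_cases i <;> simp [lineEval', pderiv_X] <;> ring

/-- The lines which a line of a surface `f = 0` meets in nonsingular points are determined by the
tangent planes. -/
theorem eq_linear_of_meets {f : MvPolynomial (Fin 3) K} {s t : K × K × K} {e c : K}
    (hst : Meets s t) (hs : lineEval' s f = 0)
    (ht : -lineEval t (pderiv 0 f) =
      (Polynomial.C e * Polynomial.X + Polynomial.C c) * lineEval t (pderiv 2 f))
    (hw : (lineEval t (pderiv 2 f)).eval s.2.2 ≠ 0) :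
    s.1 = e * s.2.2 + c ∧ s.2.1 = (t.1 - e * t.2.2) * s.2.2 + (t.2.1 - c * t.2.2) := by
  have h1 := derivative_lineEval' s f
  rw [hs, map_zero] at h1
  have h2 := congrArg (Polynomial.eval t.2.2) h1
  have h3 := congrArg (Polynomial.eval s.2.2) ht
  simp only [Polynomial.eval_zero, Polynomial.eval_add, Polynomial.eval_mul, Polynomial.eval_C,
    Polynomial.eval_neg, Polynomial.eval_X] at h2 h3
  rw [← hst.eval_eq, ← hst.eval_eq] at h2
  have h4 : s.1 = e * s.2.2 + c := by
    apply mul_right_cancel₀ hw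
    linear_combination h3 - h2
  refine ⟨h4, ?_⟩
  have h5 : s.1 * t.2.2 + s.2.1 = t.1 * s.2.2 + t.2.1 := hst
  rw [h4] at h5
  linear_combination h5

open Classical in
theorem exists_card_mul_le_of_surface {p : ℕ} [CharP K p] {d D k : ℕ} (hdp : 2 * d < p)
    (X S Y : Finset (K × K × K)) (hX : Set.InjOn (fun t : K × K × K => t.2.2) X)
    (hSX : S ⊆ X) (hYX : Y ⊆ X) (hS : S.card * (d + 1) < (d + 3).choose 3)
    (hSY : ∀ t ∈ Y, d < (S.filter fun s => Meets s t).card)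
    (hD : ∀ t ∈ Y, D ≤ (X.filter fun s => Meets s t).card)
    (hk : ∀ e c e' c' : K,
      (X.filter fun s => s.1 = e * s.2.2 + c ∧ s.2.1 = e' * s.2.2 + c').card ≤ k) :
    ∃ Y' ⊆ Y, Y.card ≤ Y'.card + d + 4 * d ^ 2 ∧
      Y'.card * D ≤ X.card * d + Y'.card * (2 * d + k) := by
  obtain ⟨f, hf0, hfd, hfS⟩ := exists_totalDegree_le_lineEval'_eq_zero S hS
  have hYf : ∀ t ∈ Y, lineEval t f = 0 := fun t ht =>
    lineEval_eq_zero_of_card (S.filter fun s => Meets s t)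
      (hX.mono (Finset.coe_subset.2 ((Finset.filter_subset _ _).trans hSX)))
      (fun s hs => ⟨(Finset.mem_filter.1 hs).2, hfS s (Finset.mem_filter.1 hs).1⟩)
      (hfd.trans_lt (hSY t ht))
  obtain ⟨g, hg0, hgd, hrel, hg1, hg2⟩ := exists_isRelPrime_pderiv (p := p) X Y hX
    (hX.mono (Finset.coe_subset.2 hYX)) d (by lia) f hf0 hfd
  have hX' : ∀ s ∈ X, lineEval' s f ≠ 0 → (Y.filter fun t => Meets s t).card ≤ d := by
    intro s hs hsf
    by_contra hcon
    refine hsf (lineEval'_eq_zero_of_card (Y.filter fun t => Meets s t)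
      (hX.mono (Finset.coe_subset.2 ((Finset.filter_subset _ _).trans hYX)))
      (fun t ht => ⟨(Finset.mem_filter.1 ht).2, hYf t (Finset.mem_filter.1 ht).1⟩) (by lia))
  obtain ⟨E, hEY, hEd, hE⟩ := exists_linear_tangent (p := p) hg0 hrel (by lia)
    (Y.filter fun t => lineEval t g = 0)
    (hX.mono (Finset.coe_subset.2 ((Finset.filter_subset _ _).trans hYX)))
    (fun t ht => (Finset.mem_filter.1 ht).2)
  refine ⟨(Y.filter fun t => lineEval t g = 0) \ E,
    Finset.sdiff_subset.trans (Finset.filter_subset _ _), ?_, ?_⟩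
  · have h1 : Y ⊆ (((Y.filter fun t => lineEval t g = 0) \ E) ∪
        (Y.filter fun t => lineEval t f = 0 ∧ lineEval t g ≠ 0)) ∪ E := by
      intro t ht
      have := hYf t ht
      simp only [Finset.mem_union, Finset.mem_sdiff, Finset.mem_filter]
      tauto
    have h2 := (Finset.card_le_card h1).trans (Finset.card_union_le _ _)
    have h3 := Finset.card_union_le ((Y.filter fun t => lineEval t g = 0) \ E)
        (Y.filter fun t => lineEval t f = 0 ∧ lineEval t g ≠ 0)
    have h4 : 4 * g.totalDegree ^ 2 ≤ 4 * d ^ 2 := by gcongr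
    lia
  set Y' := (Y.filter fun t => lineEval t g = 0) \ E with hY'
  have hY'Y : Y' ⊆ Y := Finset.sdiff_subset.trans (Finset.filter_subset _ _)
  have hdeg : ∀ t ∈ Y', D ≤ (X.filter fun s => lineEval' s f ≠ 0 ∧ Meets s t).card + (2 * d + k) := by
    intro t ht
    obtain ⟨hw, e, c, hec⟩ := hE t ht
    have h1 : (X.filter fun s => Meets s t) ⊆
        (((X.filter fun s => lineEval' s f ≠ 0 ∧ Meets s t) ∪
        (X.filter fun s => lineEval' s f = 0 ∧ lineEval' s g ≠ 0)) ∪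
        (X.filter fun s => (lineEval t (pderiv 2 g)).eval s.2.2 = 0)) ∪
        (X.filter fun s => s.1 = e * s.2.2 + c ∧
          s.2.1 = (t.1 - e * t.2.2) * s.2.2 + (t.2.1 - c * t.2.2)) := by
      intro s hs
      obtain ⟨hs, hst⟩ := Finset.mem_filter.1 hs
      have := eq_linear_of_meets (f := g) (e := e) (c := c) hst
      simp only [Finset.mem_union, Finset.mem_filter]
      tauto
    have h2 := (Finset.card_le_card h1).trans (Finset.card_union_le _ _)
    have h3 := Finset.card_union_le ((X.filter fun s => lineEval' s f ≠ 0 ∧ Meets s t) ∪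
        (X.filter fun s => lineEval' s f = 0 ∧ lineEval' s g ≠ 0))
        (X.filter fun s => (lineEval t (pderiv 2 g)).eval s.2.2 = 0)
    have h4 := Finset.card_union_le (X.filter fun s => lineEval' s f ≠ 0 ∧ Meets s t)
        (X.filter fun s => lineEval' s f = 0 ∧ lineEval' s g ≠ 0)
    have h5 := hk e c (t.1 - e * t.2.2) (t.2.1 - c * t.2.2)
    have h6 : (X.filter fun s => (lineEval t (pderiv 2 g)).eval s.2.2 = 0).card ≤ d := by
      have hinj := hX.mono (Finset.coe_subset.2 (Finset.filter_subset
        (fun s => (lineEval t (pderiv 2 g)).eval s.2.2 = 0) X))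
      rw [← Finset.card_image_of_injOn hinj]
      have h7 := Polynomial.card_le_degree_of_subset_roots (p := lineEval t (pderiv 2 g))
        (Z := (X.filter fun s => (lineEval t (pderiv 2 g)).eval s.2.2 = 0).image
          fun t : K × K × K => t.2.2) (by
          intro b hb
          obtain ⟨s, hs, rfl⟩ := Finset.mem_image.1 (Finset.mem_def.2 hb)
          exact (Polynomial.mem_roots hw).2 (Finset.mem_filter.1 hs).2)
      have := natDegree_lineEval_le t (pderiv 2 g)
      have := totalDegree_pderiv_le 2 g
      lia
    have := hD t (hY'Y ht)
    lia
  calc Y'.card * D = ∑ t ∈ Y', D := by simp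
    _ ≤ ∑ t ∈ Y', ((X.filter fun s => lineEval' s f ≠ 0 ∧ Meets s t).card + (2 * d + k)) :=
        Finset.sum_le_sum hdeg
    _ = ∑ t ∈ Y', ((X.filter fun s => lineEval' s f ≠ 0).filter fun s => Meets s t).card +
        Y'.card * (2 * d + k) := by
        rw [Finset.sum_add_distrib]
        simp only [Finset.filter_filter]
        simp
    _ = ∑ s ∈ X.filter (fun s => lineEval' s f ≠ 0), (Y'.filter fun t => Meets s t).card +
        Y'.card * (2 * d + k) := by
        simp only [Finset.card_filter]
        rw [Finset.sum_comm]
    _ ≤ ∑ s ∈ X.filter (fun s => lineEval' s f ≠ 0), d + Y'.card * (2 * d + k) := by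
        gcongr with s hs
        obtain ⟨hs, hsf⟩ := Finset.mem_filter.1 hs
        refine (Finset.card_le_card ?_).trans (hX' s hs hsf)
        exact Finset.filter_subset_filter _ hY'Y
    _ ≤ X.card * d + Y'.card * (2 * d + k) := by
        rw [Finset.sum_const, smul_eq_mul]
        gcongr
        exact Finset.filter_subset _ _

end Energy

section Sampling

/-- Among all subsets of `U` some subset behaves like a random one with density `ρ`. -/
theorem exists_subset_sum_sq_le {α ι : Type*} [DecidableEq α] (U : Finset α) (W : Finset ι)
    (a : α → ι → ℝ) {ρ : ℝ} (h0 : 0 ≤ ρ) (h1 : ρ ≤ 1) :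
    ∃ S ⊆ U, ∑ i ∈ W, (∑ u ∈ S, a u i - ρ * ∑ u ∈ U, a u i) ^ 2 ≤
      ∑ u ∈ U, ∑ i ∈ W, a u i ^ 2 := by
  induction U using Finset.induction_on with
  | empty => exact ⟨∅, subset_rfl, by simp⟩
  | insert u U hu ih =>
    obtain ⟨S, hSU, hS⟩ := ih
    have hexp : ∀ c : ℝ, c ^ 2 ≤ 1 →
        c * ∑ i ∈ W, (∑ u ∈ S, a u i - ρ * ∑ u ∈ U, a u i) * a u i ≤ 0 →
        ∑ i ∈ W, ((∑ u ∈ S, a u i - ρ * ∑ u ∈ U, a u i) + c * a u i) ^ 2 ≤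
          ∑ u ∈ insert u U, ∑ i ∈ W, a u i ^ 2 := by
      intro c hc hcs
      have h2 : ∑ i ∈ W, ((∑ u ∈ S, a u i - ρ * ∑ u ∈ U, a u i) + c * a u i) ^ 2 =
          ∑ i ∈ W, (∑ u ∈ S, a u i - ρ * ∑ u ∈ U, a u i) ^ 2 +
          2 * (c * ∑ i ∈ W, (∑ u ∈ S, a u i - ρ * ∑ u ∈ U, a u i) * a u i) +
          c ^ 2 * ∑ i ∈ W, a u i ^ 2 := by
        simp only [Finset.mul_sum, ← Finset.sum_add_distrib]
        exact Finset.sum_congr rfl fun i _ => by simp only [← Finset.mul_sum]; ring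
      have h3 : 0 ≤ ∑ i ∈ W, a u i ^ 2 := Finset.sum_nonneg fun i _ => sq_nonneg _
      rw [h2, Finset.sum_insert hu]
      nlinarith
    rcases le_total (∑ i ∈ W, (∑ u ∈ S, a u i - ρ * ∑ u ∈ U, a u i) * a u i) 0 with h | h
    · refine ⟨insert u S, Finset.insert_subset_insert _ hSU, ?_⟩
      refine le_of_eq_of_le (Finset.sum_congr rfl fun i _ => ?_)
        (hexp (1 - ρ) (by nlinarith) (mul_nonpos_of_nonneg_of_nonpos (by linarith) h))
      rw [Finset.sum_insert (fun h => hu (hSU h)), Finset.sum_insert hu]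
      ring
    · refine ⟨S, hSU.trans (Finset.subset_insert _ _), ?_⟩
      refine le_of_eq_of_le (Finset.sum_congr rfl fun i _ => ?_)
        (hexp (-ρ) (by nlinarith) (mul_nonpos_of_nonpos_of_nonneg (by linarith) h))
      rw [Finset.sum_insert hu]
      ring

/-- In a graph of large minimal degree, some sparse set of vertices contains its share of the
neighbours of most vertices. -/
theorem exists_sparse_subset {α : Type*} [DecidableEq α] (X : Finset α) (r : α → α → Prop)
    [∀ u v, Decidable (r u v)] {D ρ : ℝ} (hD : 0 < D)
    (hdeg : ∀ v ∈ X, D ≤ (X.filter fun u => r u v).card) (h0 : 0 ≤ ρ) (h1 : ρ ≤ 1) :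
    ∃ S ⊆ X, ((S.card : ℝ) - ρ * X.card) ^ 2 ≤ 2 * X.card ∧
      ((X.filter fun v => ((S.filter fun u => r u v).card : ℝ) < ρ * D / 2).card : ℝ) *
        (ρ ^ 2 * D / 4) ≤ 2 * X.card := by
  set g : α → ℝ := fun v => ((X.filter fun u => r u v).card : ℝ) with hg
  have hgpos : ∀ v ∈ X, 0 < g v := fun v hv => hD.trans_le (hdeg v hv)
  obtain ⟨S, hSX, hS⟩ := exists_subset_sum_sq_le X (Finset.insertNone X)
    (fun u i => Option.elim i 1 fun v => if r u v then √(1 / g v) else 0) h0 h1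
  simp only [Finset.sum_insertNone, Option.elim_none, Option.elim_some, Finset.sum_const,
    nsmul_eq_mul, mul_one, Finset.sum_add_distrib, one_pow] at hS
  have hsum : ∀ (Z : Finset α) (v : α), ∑ u ∈ Z, (if r u v then √(1 / g v) else 0) =
      (Z.filter fun u => r u v).card * √(1 / g v) := by
    intro Z v
    rw [← Finset.sum_filter, Finset.sum_const, nsmul_eq_mul]
  have hright : ∑ u ∈ X, ∑ v ∈ X, (if r u v then √(1 / g v) else 0) ^ 2 = X.card := by
    rw [Finset.sum_comm]
    rw [Finset.cast_card]
    refine Finset.sum_congr rfl fun v hv => ?_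
    have h2 : ∀ u, (if r u v then √(1 / g v) else 0) ^ 2 = if r u v then 1 / g v else 0 := by
      intro u
      split_ifs
      · exact Real.sq_sqrt (one_div_nonneg.2 (hgpos v hv).le)
      · simp
    simp only [h2]
    rw [← Finset.sum_filter, Finset.sum_const, nsmul_eq_mul]
    exact mul_one_div_cancel (hgpos v hv).ne'
  simp only [hsum, hright] at hS
  have hnn : 0 ≤ ∑ v ∈ X, (((S.filter fun u => r u v).card : ℝ) * √(1 / g v) -
      ρ * (((X.filter fun u => r u v).card : ℝ) * √(1 / g v))) ^ 2 :=
    Finset.sum_nonneg fun _ _ => sq_nonneg _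
  refine ⟨S, hSX, by linarith, ?_⟩
  have hbad : ((X.filter fun v => ((S.filter fun u => r u v).card : ℝ) < ρ * D / 2).card : ℝ) *
        (ρ ^ 2 * D / 4) ≤
      ∑ v ∈ X, (((S.filter fun u => r u v).card : ℝ) * √(1 / g v) -
      ρ * (((X.filter fun u => r u v).card : ℝ) * √(1 / g v))) ^ 2 := by
    rw [← nsmul_eq_mul, ← Finset.sum_const]
    refine (Finset.sum_le_sum fun v hv => ?_).trans
      (Finset.sum_le_sum_of_subset_of_nonneg (Finset.filter_subset _ X)
        fun _ _ _ => sq_nonneg _)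
    obtain ⟨hv, hlt⟩ := Finset.mem_filter.1 hv
    have hgv := hgpos v hv
    have hDv : D ≤ g v := hdeg v hv
    rw [← mul_assoc, ← sub_mul, mul_pow, Real.sq_sqrt (one_div_nonneg.2 hgv.le), mul_one_div,
      le_div_iff₀ hgv]
    have h3 : ρ * g v / 2 ≤ ρ * g v - ((S.filter fun u => r u v).card : ℝ) := by nlinarith
    have h4 : (ρ * g v / 2) ^ 2 ≤ (ρ * g v - ((S.filter fun u => r u v).card : ℝ)) ^ 2 := by
      gcongr
    calc ρ ^ 2 * D / 4 * g v ≤ ρ ^ 2 * g v / 4 * g v := by gcongr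
      _ = (ρ * g v / 2) ^ 2 := by ring
      _ ≤ _ := h4
      _ = _ := by rw [← neg_sq, neg_sub]
  have := sq_nonneg ((S.card : ℝ) - ρ * X.card)
  linarith

end Sampling

section MeetingPairs

open Classical in
/-- A vertex of small degree in the graph of meeting lines. -/
theorem exists_card_meets_le {K : Type*} [Field K] {p : ℕ} [CharP K p] {k : ℕ}
    (X : Finset (K × K × K)) (hX : Set.InjOn (fun t : K × K × K => t.2.2) X)
    (hX0 : X.Nonempty) (hXp : X.card ≤ p ^ 2)
    (hk : ∀ e c e' c' : K,
      (X.filter fun s => s.1 = e * s.2.2 + c ∧ s.2.1 = e' * s.2.2 + c').card ≤ k) :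
    ∃ t ∈ X, ((X.filter fun s => Meets s t).card : ℝ) ≤ 10 ^ 4 * (√X.card + k) := by
  by_contra! hcon
  set N := X.card with hN
  set s : ℝ := √N with hs
  have hN0 : 0 < N := hX0.card_pos
  have hs0 : 0 < s := Real.sqrt_pos.2 (by exact_mod_cast hN0)
  have hss : s ^ 2 = N := Real.sq_sqrt (Nat.cast_nonneg _)
  set D : ℕ := ⌊(10 : ℝ) ^ 4 * (s + k)⌋₊ + 1 with hDdef
  have hD : (10 : ℝ) ^ 4 * (s + k) < D := by
    rw [hDdef]; push_cast; exact Nat.lt_floor_add_one _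
  have hdeg : ∀ t ∈ X, D ≤ (X.filter fun s => Meets s t).card := fun t ht =>
    Nat.succ_le_of_lt ((Nat.floor_lt (by positivity)).2 (hcon t ht))
  have hk0 : (0 : ℝ) ≤ k := Nat.cast_nonneg _
  have hDN : (D : ℝ) ≤ N := by
    obtain ⟨t, ht⟩ := hX0
    exact_mod_cast (hdeg t ht).trans (Finset.card_le_card (Finset.filter_subset _ _))
  have hs4 : (10 : ℝ) ^ 4 < s := by nlinarith
  have hN8 : (10 : ℝ) ^ 8 < N := by nlinarith
  have hD8 : (10 : ℝ) ^ 8 < D := by nlinarith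
  set d := Nat.sqrt (N / 40) with hd
  have hd1 : 40 * d ^ 2 ≤ N := by
    have := Nat.sqrt_le' (N / 40)
    lia
  have hd2 : N < 40 * (d + 1) ^ 2 := by
    have := Nat.lt_succ_sqrt' (N / 40)
    rw [← hd, Nat.succ_eq_add_one] at this
    lia
  have hds : 6 * (d : ℝ) ≤ s := by
    have : 40 * (d : ℝ) ^ 2 ≤ N := by exact_mod_cast hd1
    nlinarith
  obtain ⟨S, hSX, hS1, hS2⟩ := exists_sparse_subset X (fun s t => Meets s t) (D := D)
    (ρ := 1 / 480) (by positivity) (fun v hv => by exact_mod_cast hdeg v hv)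
    (by norm_num) (by norm_num)
  rw [← hN] at hS1 hS2
  set B := X.filter fun v => ((S.filter fun u => Meets u v).card : ℝ) < 1 / 480 * D / 2 with hB
  have hScard : 240 * S.card ≤ N := by
    have : 240 * (S.card : ℝ) ≤ N := by
      by_contra! h
      have h1 : (N : ℝ) / 480 < S.card - 1 / 480 * N := by linarith
      nlinarith
    exact_mod_cast this
  have hBcard : 8 * (B.card : ℝ) ≤ N := by
    have : (0 : ℝ) ≤ B.card := Nat.cast_nonneg _
    nlinarith
  obtain ⟨Y', hY', hY'1, hY'2⟩ := exists_card_mul_le_of_surface (p := p) (d := d) (D := D) (k := k)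
    (by
      have : (2 * d) ^ 2 < p ^ 2 := by nlinarith
      exact lt_of_pow_lt_pow_left₀ 2 (Nat.zero_le _) this)
    X S (X \ B) hX hSX Finset.sdiff_subset (by
      have h1 := Nat.descFactorial_eq_factorial_mul_choose (d + 3) 3
      simp only [Nat.descFactorial, Nat.factorial] at h1
      norm_num at h1
      have h2 : 6 * S.card < (d + 2) * (d + 3) := by nlinarith
      rw [show d + 3 - 2 = d + 1 by lia] at h1
      have h3 := Nat.mul_lt_mul_of_pos_right h2 (Nat.succ_pos d)
      rw [Nat.succ_eq_add_one] at h3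
      linarith) (by
      intro t ht
      simp only [hB, Finset.mem_sdiff, Finset.mem_filter, not_and, not_lt] at ht
      have h1 := ht.2 ht.1
      have : (d : ℝ) < (S.filter fun s => Meets s t).card := by nlinarith
      exact_mod_cast this)
    (fun t ht => hdeg t (Finset.mem_sdiff.1 ht).1) hk
  have hYcard : (N : ℝ) ≤ (X \ B).card + B.card := by
    have := Finset.card_sdiff_add_card_eq_card (Finset.filter_subset
      (fun v => ((S.filter fun u => Meets u v).card : ℝ) < 1 / 480 * D / 2) X)
    exact_mod_cast this.ge
  have hY'3 : ((X \ B).card : ℝ) ≤ Y'.card + d + 4 * d ^ 2 := by exact_mod_cast hY'1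
  have hY'4 : (Y'.card : ℝ) * D ≤ N * d + Y'.card * (2 * d + k) := by exact_mod_cast hY'2
  have hdd : (d : ℝ) ≤ d ^ 2 := by exact_mod_cast Nat.le_self_pow two_ne_zero d
  have hd1' : 40 * (d : ℝ) ^ 2 ≤ N := by exact_mod_cast hd1
  have hbig : 3 / 4 * (N : ℝ) ≤ Y'.card := by linarith
  have hd0 : (0 : ℝ) ≤ d := Nat.cast_nonneg _
  have hgap : 2 * (d : ℝ) < D - (2 * d + k) := by nlinarith
  have hNpos : (0 : ℝ) < N := by exact_mod_cast hN0
  nlinarith [mul_le_mul_of_nonneg_right hbig (by linarith : (0 : ℝ) ≤ D - (2 * d + k)),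
    mul_lt_mul_of_pos_left hgap hNpos, mul_nonneg hNpos.le hd0]

open Classical in
theorem sum_card_filter_le_of_forall_exists {α : Type*} (r : α → α → Prop)
    (hr : ∀ u v, r u v → r v u) {D : ℝ} (X : Finset α)
    (h : ∀ Z ⊆ X, Z.Nonempty → ∃ v ∈ Z, ((Z.filter fun u => r u v).card : ℝ) ≤ D) :
    ∑ v ∈ X, ((X.filter fun u => r u v).card : ℝ) ≤ 2 * D * X.card := by
  induction X using Finset.strongInduction with
  | H X ih =>
  rcases X.eq_empty_or_nonempty with rfl | hX
  · simp
  obtain ⟨v, hv, hvD⟩ := h X subset_rfl hX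
  have h1 := ih (X.erase v) (Finset.erase_ssubset hv)
    fun Z hZ => h Z (hZ.trans (Finset.erase_subset _ _))
  have h2 : ∀ u ∈ X.erase v, ((X.filter fun w => r w u).card : ℝ) =
      (((X.erase v).filter fun w => r w u).card : ℝ) + if r v u then 1 else 0 := by
    intro u _
    conv_lhs => rw [← Finset.insert_erase hv]
    rw [Finset.filter_insert]
    split_ifs
    · rw [Finset.card_insert_of_notMem (by simp)]; push_cast; rfl
    · simp
  have h3 : ∑ u ∈ X.erase v, (if r v u then 1 else 0 : ℝ) ≤ D := by
    rw [← Finset.sum_filter, Finset.sum_const, nsmul_eq_mul, mul_one]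
    refine le_trans (Nat.cast_le.2 (Finset.card_le_card ?_)) hvD
    intro u hu
    simp only [Finset.mem_filter, Finset.mem_erase] at hu ⊢
    exact ⟨hu.1.2, hr _ _ hu.2⟩
  have h4 : ((X.erase v).card : ℝ) = X.card - 1 := by
    rw [← Finset.card_erase_add_one hv]; push_cast; ring
  rw [← Finset.add_sum_erase _ _ hv, Finset.sum_congr rfl h2, Finset.sum_add_distrib]
  rw [h4] at h1
  linarith

open Classical in
theorem sum_card_meets_le {K : Type*} [Field K] {p : ℕ} [CharP K p] {k : ℕ}
    (X : Finset (K × K × K)) (hX : Set.InjOn (fun t : K × K × K => t.2.2) X)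
    (hXp : X.card ≤ p ^ 2)
    (hk : ∀ e c e' c' : K,
      (X.filter fun s => s.1 = e * s.2.2 + c ∧ s.2.1 = e' * s.2.2 + c').card ≤ k) :
    ∑ t ∈ X, ((X.filter fun s => Meets s t).card : ℝ) ≤
      2 * (10 ^ 4 * (√X.card + k)) * X.card := by
  refine sum_card_filter_le_of_forall_exists _ (fun _ _ => Meets.symm) X fun Z hZ hZ0 => ?_
  obtain ⟨t, ht, h⟩ := exists_card_meets_le (p := p) (k := k) Z
    (hX.mono (Finset.coe_subset.2 hZ)) hZ0 ((Finset.card_le_card hZ).trans hXp)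
    fun e c e' c' => (Finset.card_le_card (Finset.filter_subset_filter _ hZ)).trans (hk e c e' c')
  refine ⟨t, ht, h.trans ?_⟩
  gcongr

end MeetingPairs

section Lift

variable {F : Type*} [Field F]

/-- The line in space over the rational functions attached to the line `y = m x + n` of the plane
and the abscissa `a`. -/
noncomputable def liftLine (v : (F × F) × F) : RatFunc F × RatFunc F × RatFunc F :=
  (RatFunc.C v.1.1 / (1 + RatFunc.X * RatFunc.C v.1.1),
    RatFunc.C v.1.2 / (1 + RatFunc.X * RatFunc.C v.1.1),
    (RatFunc.C v.2 + RatFunc.X ^ 3 * RatFunc.C v.1.1 + RatFunc.X * RatFunc.C v.1.2) /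
      (1 + RatFunc.X * RatFunc.C v.1.1))

theorem one_add_X_mul_C_ne_zero (m : F) : (1 + RatFunc.X * RatFunc.C m : RatFunc F) ≠ 0 := by
  intro h
  have h1 : algebraMap (Polynomial F) (RatFunc F) (1 + Polynomial.X * Polynomial.C m) = 0 := by
    rw [← h]
    simp only [map_add, map_mul, map_one, RatFunc.algebraMap_X, RatFunc.algebraMap_C]
  rw [map_eq_zero_iff _ (RatFunc.algebraMap_injective F)] at h1
  simpa using congrArg (fun q => q.coeff 0) h1

theorem meets_liftLine_iff (u v : (F × F) × F) :
    Meets (liftLine u) (liftLine v) ↔ u.1.1 * v.2 + u.1.2 = v.1.1 * u.2 + v.1.2 := by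
  have hu := one_add_X_mul_C_ne_zero u.1.1
  have hv := one_add_X_mul_C_ne_zero v.1.1
  have hu' := hu
  have hv' := hv
  rw [mul_comm] at hu' hv'
  rw [← (RatFunc.C : F →+* RatFunc F).injective.eq_iff]
  simp only [Meets, liftLine, map_add, map_mul]
  field_simp
  constructor
  · intro h
    linear_combination h
  · intro h
    linear_combination h

theorem liftLine_injective_snd : Function.Injective fun v : (F × F) × F => (liftLine v).2.2 := by
  intro u v h
  have hu := one_add_X_mul_C_ne_zero u.1.1
  have hv := one_add_X_mul_C_ne_zero v.1.1
  simp only [liftLine] at h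
  rw [div_eq_div_iff hu hv] at h
  have h1 : (Polynomial.C u.2 + Polynomial.X * Polynomial.C (u.1.2 + u.2 * v.1.1) +
      Polynomial.X ^ 2 * Polynomial.C (u.1.2 * v.1.1) + Polynomial.X ^ 3 * Polynomial.C u.1.1 +
      Polynomial.X ^ 4 * Polynomial.C (u.1.1 * v.1.1) : Polynomial F) =
      Polynomial.C v.2 + Polynomial.X * Polynomial.C (v.1.2 + v.2 * u.1.1) +
      Polynomial.X ^ 2 * Polynomial.C (v.1.2 * u.1.1) + Polynomial.X ^ 3 * Polynomial.C v.1.1 +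
      Polynomial.X ^ 4 * Polynomial.C (v.1.1 * u.1.1) := by
    apply RatFunc.algebraMap_injective F
    simp only [map_add, map_mul, map_pow, RatFunc.algebraMap_X, RatFunc.algebraMap_C]
    linear_combination h
  have c0 := congrArg (fun q => q.coeff 0) h1
  have c1 := congrArg (fun q => q.coeff 1) h1
  have c3 := congrArg (fun q => q.coeff 3) h1
  simp [Polynomial.coeff_X_pow_mul', Polynomial.coeff_C] at c0 c1 c3
  rw [c0, c3] at c1
  refine Prod.ext (Prod.ext c3 ?_) c0
  linear_combination c1

variable {e c e' c' : RatFunc F}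

theorem liftLine_linear {v : (F × F) × F}
    (hv : (liftLine v).1 = e * (liftLine v).2.2 + c ∧ (liftLine v).2.1 = e' * (liftLine v).2.2 + c') :
    RatFunc.C v.1.1 = e * (RatFunc.C v.2 + RatFunc.X ^ 3 * RatFunc.C v.1.1 +
        RatFunc.X * RatFunc.C v.1.2) + c * (1 + RatFunc.X * RatFunc.C v.1.1) ∧
      RatFunc.C v.1.2 = e' * (RatFunc.C v.2 + RatFunc.X ^ 3 * RatFunc.C v.1.1 +
        RatFunc.X * RatFunc.C v.1.2) + c' * (1 + RatFunc.X * RatFunc.C v.1.1) := by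
  have h := one_add_X_mul_C_ne_zero v.1.1
  simp only [liftLine] at hv
  obtain ⟨h1, h2⟩ := hv
  rw [← mul_div_assoc, div_add' _ _ _ h, div_left_inj' h] at h1 h2
  exact ⟨h1, h2⟩

theorem c_mul_X_ne_one {v : (F × F) × F} (he : e = 0)
    (hv : (liftLine v).1 = e * (liftLine v).2.2 + c ∧ (liftLine v).2.1 = e' * (liftLine v).2.2 + c') :
    1 - c * RatFunc.X ≠ 0 := by
  intro h
  have h1 := (liftLine_linear hv).1
  subst he
  have h2 : c = 0 := by linear_combination -h1 + RatFunc.C v.1.1 * h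
  simp [h2] at h

/-- Lines attached to triples on a common regulus come from collinear points of the dual plane. -/
theorem collinear_of_liftLine {u v w : (F × F) × F}
    (hu : (liftLine u).1 = e * (liftLine u).2.2 + c ∧ (liftLine u).2.1 = e' * (liftLine u).2.2 + c')
    (hv : (liftLine v).1 = e * (liftLine v).2.2 + c ∧ (liftLine v).2.1 = e' * (liftLine v).2.2 + c')
    (hw : (liftLine w).1 = e * (liftLine w).2.2 + c ∧ (liftLine w).2.1 = e' * (liftLine w).2.2 + c') :
    (v.1.1 - u.1.1) * (w.1.2 - u.1.2) = (w.1.1 - u.1.1) * (v.1.2 - u.1.2) := by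
  apply (RatFunc.C : F →+* RatFunc F).injective
  simp only [map_mul, map_sub]
  obtain ⟨u1, u2⟩ := liftLine_linear hu
  obtain ⟨v1, v2⟩ := liftLine_linear hv
  obtain ⟨w1, w2⟩ := liftLine_linear hw
  obtain ⟨Bv, hBv⟩ : ∃ B, B = RatFunc.C v.2 - RatFunc.C u.2 +
    RatFunc.X ^ 3 * (RatFunc.C v.1.1 - RatFunc.C u.1.1) +
    RatFunc.X * (RatFunc.C v.1.2 - RatFunc.C u.1.2) := ⟨_, rfl⟩
  obtain ⟨Bw, hBw⟩ : ∃ B, B = RatFunc.C w.2 - RatFunc.C u.2 +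
    RatFunc.X ^ 3 * (RatFunc.C w.1.1 - RatFunc.C u.1.1) +
    RatFunc.X * (RatFunc.C w.1.2 - RatFunc.C u.1.2) := ⟨_, rfl⟩
  have v3 : (1 - c * RatFunc.X) * (RatFunc.C v.1.1 - RatFunc.C u.1.1) = e * Bv := by
    rw [hBv]; linear_combination v1 - u1
  have w3 : (1 - c * RatFunc.X) * (RatFunc.C w.1.1 - RatFunc.C u.1.1) = e * Bw := by
    rw [hBw]; linear_combination w1 - u1
  have v4 : RatFunc.C v.1.2 - RatFunc.C u.1.2 =
      e' * Bv + c' * RatFunc.X * (RatFunc.C v.1.1 - RatFunc.C u.1.1) := by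
    rw [hBv]; linear_combination v2 - u2
  have w4 : RatFunc.C w.1.2 - RatFunc.C u.1.2 =
      e' * Bw + c' * RatFunc.X * (RatFunc.C w.1.1 - RatFunc.C u.1.1) := by
    rw [hBw]; linear_combination w2 - u2
  rw [v4, w4]
  by_cases h : 1 - c * RatFunc.X = 0
  · have he : e ≠ 0 := fun he => c_mul_X_ne_one he hu h
    rw [h, zero_mul] at v3 w3
    rw [(mul_eq_zero.1 v3.symm).resolve_left he, (mul_eq_zero.1 w3.symm).resolve_left he]
    ring
  · apply mul_left_cancel₀ h
    linear_combination e' * Bw * v3 - e' * Bv * w3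

theorem fst_eq_of_liftLine {u v w : (F × F) × F}
    (hu : (liftLine u).1 = e * (liftLine u).2.2 + c ∧ (liftLine u).2.1 = e' * (liftLine u).2.2 + c')
    (hv : (liftLine v).1 = e * (liftLine v).2.2 + c ∧ (liftLine v).2.1 = e' * (liftLine v).2.2 + c')
    (hw : (liftLine w).1 = e * (liftLine w).2.2 + c ∧ (liftLine w).2.1 = e' * (liftLine w).2.2 + c')
    (huv : u.1 = v.1) (hne : u ≠ v) : w.1 = u.1 := by
  obtain ⟨u1, u2⟩ := liftLine_linear hu
  obtain ⟨v1, v2⟩ := liftLine_linear hv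
  obtain ⟨w1, w2⟩ := liftLine_linear hw
  have h2 : (RatFunc.C v.2 - RatFunc.C u.2 : RatFunc F) ≠ 0 := by
    rw [sub_ne_zero, (RatFunc.C : F →+* RatFunc F).injective.ne_iff]
    exact fun h => hne (Prod.ext huv h.symm)
  rw [← huv] at v1 v2
  have he : e = 0 := (mul_eq_zero.1 (by linear_combination u1 - v1 :
    e * (RatFunc.C v.2 - RatFunc.C u.2) = 0)).resolve_right h2
  have he' : e' = 0 := (mul_eq_zero.1 (by linear_combination u2 - v2 :
    e' * (RatFunc.C v.2 - RatFunc.C u.2) = 0)).resolve_right h2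
  have h3 := c_mul_X_ne_one he hu
  rw [he] at u1 w1
  rw [he'] at u2 w2
  have h4 : (RatFunc.C w.1.1 : RatFunc F) = RatFunc.C u.1.1 := by
    apply mul_left_cancel₀ h3
    linear_combination w1 - u1
  rw [h4] at w2
  refine Prod.ext ((RatFunc.C : F →+* RatFunc F).injective h4)
    ((RatFunc.C : F →+* RatFunc F).injective ?_)
  linear_combination w2 - u2

open Classical in
/-- The number of quadruples `(ℓ, a, m, b)` with `ℓ(b) = m(a)`. -/
theorem sum_card_filter_eval_eq_le {p : ℕ} [CharP F p] {k : ℕ} (L : Finset (F × F))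
    (A : Finset F) (hp : L.card * A.card ≤ p ^ 2) (hA : A.card ≤ k)
    (hm : ∀ m, (L.filter fun ℓ => ℓ.1 = m).card ≤ k)
    (hxy : ∀ x y, (L.filter fun ℓ => ℓ.1 * x + ℓ.2 = y).card ≤ k) :
    ∑ v ∈ L ×ˢ A, (((L ×ˢ A).filter fun u => u.1.1 * v.2 + u.1.2 = v.1.1 * u.2 + v.1.2).card : ℝ) ≤
      2 * (10 ^ 4 * (√(L.card * A.card) + k)) * (L.card * A.card) := by
  have hinj : Function.Injective (liftLine (F := F)) :=
    fun u v h => liftLine_injective_snd (congrArg (fun t => t.2.2) h)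
  have : CharP (RatFunc F) p :=
    charP_of_injective_ringHom (RatFunc.C : F →+* RatFunc F).injective p
  have hcard : ((L ×ˢ A).image liftLine).card = L.card * A.card := by
    rw [Finset.card_image_of_injective _ hinj, Finset.card_product]
  have hfilter : ∀ (q : RatFunc F × RatFunc F × RatFunc F → Prop) [DecidablePred q],
      (((L ×ˢ A).image liftLine).filter q).card =
        ((L ×ˢ A).filter fun v => q (liftLine v)).card := by
    intro q _
    rw [Finset.filter_image, Finset.card_image_of_injective _ hinj]
  have key := sum_card_meets_le (p := p) (k := k) ((L ×ˢ A).image liftLine) (by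
    intro s hs t ht hst
    simp only [Finset.coe_image, Set.mem_image] at hs ht
    obtain ⟨u, _, rfl⟩ := hs
    obtain ⟨v, _, rfl⟩ := ht
    rw [liftLine_injective_snd hst]) (hcard.trans_le hp) (by
    intro e c e' c'
    rw [hfilter]
    set Z := (L ×ˢ A).filter fun v => (liftLine v).1 = e * (liftLine v).2.2 + c ∧
      (liftLine v).2.1 = e' * (liftLine v).2.2 + c' with hZ
    have hZ1 : ∀ v ∈ Z, v.1 ∈ L ∧ v.2 ∈ A := fun v hv =>
      Finset.mem_product.1 (Finset.mem_filter.1 hv).1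
    rcases Z.eq_empty_or_nonempty with h0 | ⟨v₀, hv₀⟩
    · simp [h0]
    by_cases hZinj : Set.InjOn Prod.fst (Z : Set ((F × F) × F))
    · rw [← Finset.card_image_of_injOn hZinj]
      by_cases hpar : ∀ v ∈ Z, v.1.1 = v₀.1.1
      · refine (Finset.card_le_card ?_).trans (hm v₀.1.1)
        intro ℓ hℓ
        obtain ⟨v, hv, rfl⟩ := Finset.mem_image.1 hℓ
        exact Finset.mem_filter.2 ⟨(hZ1 v hv).1, hpar v hv⟩
      · push Not at hpar
        obtain ⟨v₁, hv₁, hne⟩ := hpar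
        have hne' := sub_ne_zero.2 hne
        refine (Finset.card_le_card ?_).trans
          (hxy (-(v₁.1.2 - v₀.1.2) / (v₁.1.1 - v₀.1.1))
            (v₀.1.1 * (-(v₁.1.2 - v₀.1.2) / (v₁.1.1 - v₀.1.1)) + v₀.1.2))
        intro ℓ hℓ
        obtain ⟨v, hv, rfl⟩ := Finset.mem_image.1 hℓ
        refine Finset.mem_filter.2 ⟨(hZ1 v hv).1, ?_⟩
        have := collinear_of_liftLine (Finset.mem_filter.1 hv₀).2 (Finset.mem_filter.1 hv₁).2
          (Finset.mem_filter.1 hv).2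
        field_simp
        linear_combination this
    · rw [Set.InjOn] at hZinj
      push Not at hZinj
      obtain ⟨u, hu, v, hv, huv, hne⟩ := hZinj
      refine le_trans ?_ hA
      rw [← Finset.card_image_of_injOn (s := Z) (f := Prod.snd)]
      · refine Finset.card_le_card ?_
        intro a ha
        obtain ⟨w, hw, rfl⟩ := Finset.mem_image.1 ha
        exact (hZ1 w hw).2
      · have hall : ∀ w ∈ Z, w.1 = u.1 := fun w hw =>
          fst_eq_of_liftLine (Finset.mem_filter.1 hu).2 (Finset.mem_filter.1 hv).2
            (Finset.mem_filter.1 hw).2 huv hne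
        intro w hw w' hw' h
        exact Prod.ext ((hall w hw).trans (hall w' hw').symm) h)
  rw [Finset.sum_image hinj.injOn, hcard] at key
  simp only [hfilter, meets_liftLine_iff, Nat.cast_mul] at key
  exact key

end Lift

section Incidences

open Classical in
theorem card_mul_le_of_injOn {F : Type*} [Field F] {r : ℝ} (A B : Finset F) (Z : Finset (F × F))
    (x₀ : F) (hZ : ∀ a ∈ A, a ≠ x₀ → Set.InjOn (fun ℓ : F × F => ℓ.1 * a + ℓ.2) Z)
    (hr : ∀ ℓ ∈ Z, r ≤ (A.filter fun a => ℓ.1 * a + ℓ.2 ∈ B).card) :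
    Z.card * (r - 1) ≤ A.card * B.card := by
  have h1 : ∀ ℓ ∈ Z, r - 1 ≤ ((A.erase x₀).filter fun a => ℓ.1 * a + ℓ.2 ∈ B).card := by
    intro ℓ hℓ
    have h2 : (A.filter fun a => ℓ.1 * a + ℓ.2 ∈ B) ⊆
        insert x₀ ((A.erase x₀).filter fun a => ℓ.1 * a + ℓ.2 ∈ B) := by
      intro a ha
      simp only [Finset.mem_insert, Finset.mem_filter, Finset.mem_erase] at ha ⊢
      tauto
    have h3 : ((A.filter fun a => ℓ.1 * a + ℓ.2 ∈ B).card : ℝ) ≤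
        ((A.erase x₀).filter fun a => ℓ.1 * a + ℓ.2 ∈ B).card + 1 := by
      exact_mod_cast (Finset.card_le_card h2).trans (Finset.card_insert_le _ _)
    linarith [hr ℓ hℓ]
  have h4 : ∀ a ∈ A.erase x₀, (Z.filter fun ℓ => ℓ.1 * a + ℓ.2 ∈ B).card ≤ B.card := by
    intro a ha
    obtain ⟨hne, ha⟩ := Finset.mem_erase.1 ha
    exact Finset.card_le_card_of_injOn (fun ℓ => ℓ.1 * a + ℓ.2)
      (fun ℓ hℓ => (Finset.mem_filter.1 hℓ).2)
      ((hZ a ha hne).mono (Finset.coe_subset.2 (Finset.filter_subset _ _)))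
  calc (Z.card : ℝ) * (r - 1) = ∑ ℓ ∈ Z, (r - 1) := by
        rw [Finset.sum_const, nsmul_eq_mul]
    _ ≤ ∑ ℓ ∈ Z, (((A.erase x₀).filter fun a => ℓ.1 * a + ℓ.2 ∈ B).card : ℝ) :=
        Finset.sum_le_sum h1
    _ = ∑ a ∈ A.erase x₀, ((Z.filter fun ℓ => ℓ.1 * a + ℓ.2 ∈ B).card : ℝ) := by
        simp only [Finset.card_filter, Nat.cast_sum]
        exact Finset.sum_comm
    _ ≤ ∑ a ∈ A.erase x₀, (B.card : ℝ) := Finset.sum_le_sum fun a ha => by exact_mod_cast h4 a ha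
    _ ≤ A.card * B.card := by
        rw [Finset.sum_const, nsmul_eq_mul]
        gcongr
        exact Finset.erase_subset _ _

open Classical in
theorem sq_sum_card_filter_mem_le {F : Type*} [Field F] (A B : Finset F) (L : Finset (F × F)) :
    (∑ ℓ ∈ L, ((A.filter fun a => ℓ.1 * a + ℓ.2 ∈ B).card : ℝ)) ^ 2 ≤
      B.card * ∑ v ∈ L ×ˢ A,
        (((L ×ˢ A).filter fun u => u.1.1 * v.2 + u.1.2 = v.1.1 * u.2 + v.1.2).card : ℝ) := by
  have h1 : ∑ ℓ ∈ L, ((A.filter fun a => ℓ.1 * a + ℓ.2 ∈ B).card : ℝ) =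
      ∑ b ∈ B, ∑ v ∈ L ×ˢ A, if v.1.1 * v.2 + v.1.2 = b then (1 : ℝ) else 0 := by
    rw [Finset.sum_comm]
    simp only [Finset.sum_ite_eq, Finset.sum_product, Finset.card_filter, Nat.cast_sum,
      Nat.cast_ite, Nat.cast_one, Nat.cast_zero]
  rw [h1]
  refine (sq_sum_le_card_mul_sum_sq (s := B)).trans ?_
  gcongr
  calc ∑ b ∈ B, (∑ v ∈ L ×ˢ A, if v.1.1 * v.2 + v.1.2 = b then (1 : ℝ) else 0) ^ 2
      = ∑ v ∈ L ×ˢ A, ∑ u ∈ L ×ˢ A, ∑ b ∈ B, (if v.1.1 * v.2 + v.1.2 = b then (1 : ℝ) else 0) *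
          (if u.1.1 * u.2 + u.1.2 = b then (1 : ℝ) else 0) := by
        simp only [sq, Finset.sum_mul_sum]
        rw [Finset.sum_comm]
        exact Finset.sum_congr rfl fun v _ => Finset.sum_comm
    _ ≤ ∑ v ∈ L ×ˢ A, ∑ u ∈ L ×ˢ A,
          if u.1.1 * u.2 + u.1.2 = v.1.1 * v.2 + v.1.2 then (1 : ℝ) else 0 := by
        refine Finset.sum_le_sum fun v _ => Finset.sum_le_sum fun u _ => ?_
        simp only [ite_mul, one_mul, zero_mul, Finset.sum_ite_eq]
        split_ifs <;> simp
    _ = ∑ v ∈ L ×ˢ A, ∑ u ∈ L ×ˢ A,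
          if u.1.1 * v.2 + u.1.2 = v.1.1 * u.2 + v.1.2 then (1 : ℝ) else 0 := by
        simp only [Finset.sum_product]
        refine Finset.sum_congr rfl fun ℓ _ => ?_
        conv_lhs => rw [Finset.sum_comm]
        conv_rhs => rw [Finset.sum_comm]
        exact Finset.sum_congr rfl fun ℓ' _ => Finset.sum_comm
    _ = _ := by
        simp only [Finset.card_filter, Nat.cast_sum, Nat.cast_ite, Nat.cast_one, Nat.cast_zero]

open Classical in
theorem half_sum_le_sum_filter {α : Type*} (L : Finset α) (g : α → ℝ) {r : ℝ}
    (hr : r * L.card = (∑ ℓ ∈ L, g ℓ) / 2) (hr0 : 0 ≤ r) :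
    (∑ ℓ ∈ L, g ℓ) / 2 ≤ ∑ ℓ ∈ L.filter (fun ℓ => r ≤ g ℓ), g ℓ := by
  have h1 := Finset.sum_filter_add_sum_filter_not L (fun ℓ => r ≤ g ℓ) g
  have h2 : ∑ ℓ ∈ L.filter (fun ℓ => ¬ r ≤ g ℓ), g ℓ ≤ r * L.card := by
    calc ∑ ℓ ∈ L.filter (fun ℓ => ¬ r ≤ g ℓ), g ℓ ≤ ∑ ℓ ∈ L.filter (fun ℓ => ¬ r ≤ g ℓ), r :=
          Finset.sum_le_sum fun ℓ hℓ => (not_le.1 (Finset.mem_filter.1 hℓ).2).le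
      _ ≤ r * L.card := by
          rw [Finset.sum_const, nsmul_eq_mul, mul_comm]
          exact mul_le_mul_of_nonneg_left (Nat.cast_le.2 (Finset.card_filter_le _ _)) hr0
  linarith

open Classical in
theorem sum_card_filter_mem_le {F : Type*} [Field F] {p : ℕ} [CharP F p] (A B : Finset F)
    (L : Finset (F × F)) (hAB : A.card ≤ B.card) (hp : A.card * L.card ≤ p ^ 2) {x y : ℝ}
    (hx : 0 ≤ x) (hy : 0 ≤ y) (hx4 : x ^ 4 = A.card * L.card) (hy2 : y ^ 2 = B.card) :
    ∑ ℓ ∈ L, ((A.filter fun a => ℓ.1 * a + ℓ.2 ∈ B).card : ℝ) ≤ 500 * (x ^ 3 * y + L.card) := by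
  obtain ⟨g, hg⟩ : ∃ g : F × F → ℝ,
      ∀ ℓ, ((A.filter fun a => ℓ.1 * a + ℓ.2 ∈ B).card : ℝ) = g ℓ := ⟨_, fun _ => rfl⟩
  simp only [hg]
  have hL0 : (0 : ℝ) ≤ L.card := Nat.cast_nonneg _
  rcases le_or_gt x y with hxy | hxy
  · have h1 : ∑ ℓ ∈ L, g ℓ ≤ x ^ 4 := by
      calc ∑ ℓ ∈ L, g ℓ ≤ ∑ ℓ ∈ L, (A.card : ℝ) := Finset.sum_le_sum fun ℓ _ => by
            rw [← hg]
            exact Nat.cast_le.2 (Finset.card_filter_le _ _)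
        _ = x ^ 4 := by rw [hx4, Finset.sum_const, nsmul_eq_mul, mul_comm]
    have h2 : x ^ 4 ≤ x ^ 3 * y := by rw [pow_succ]; gcongr
    have h3 : 0 ≤ x ^ 3 * y := by positivity
    linarith
  by_contra! hcon
  obtain ⟨I, hI⟩ : ∃ I, ∑ ℓ ∈ L, g ℓ = I := ⟨_, rfl⟩
  rw [hI] at hcon
  have hxy0 : 0 ≤ x ^ 3 * y := by positivity
  have hIpos : 0 < I := by nlinarith
  have hLpos : (0 : ℝ) < L.card := by
    rw [Nat.cast_pos, Finset.card_pos]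
    by_contra h
    rw [Finset.not_nonempty_iff_eq_empty] at h
    rw [← hI, h, Finset.sum_empty] at hIpos
    exact lt_irrefl _ hIpos
  have hx0 : 0 < x := hy.trans_lt hxy
  obtain ⟨r, hr⟩ : ∃ r : ℝ, r = I / (2 * L.card) := ⟨_, rfl⟩
  have hrL : r * L.card = I / 2 := by rw [hr]; field_simp
  have hr2 : 2 ≤ r := by
    rw [hr, le_div_iff₀ (by positivity)]; linarith
  obtain ⟨L₂, hL₂⟩ : ∃ L₂, L₂ = L.filter fun ℓ => r ≤ g ℓ := ⟨_, rfl⟩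
  have hI₂ : I / 2 ≤ ∑ ℓ ∈ L₂, g ℓ := by
    rw [hL₂, ← hI]
    exact half_sum_le_sum_filter L g (hI ▸ hrL) (by linarith)
  have hL₂card : (L₂.card : ℝ) ≤ L.card := by
    rw [hL₂]
    exact_mod_cast Finset.card_filter_le _ _
  have hconc : ∀ Z ⊆ L₂, ∀ x₀ : F,
      (∀ a ∈ A, a ≠ x₀ → Set.InjOn (fun ℓ : F × F => ℓ.1 * a + ℓ.2) Z) →
      Z.card ≤ ⌊x ^ 2⌋₊ := by
    intro Z hZ x₀ hinj
    have h1 := card_mul_le_of_injOn A B Z x₀ hinj fun ℓ hℓ =>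
      (Finset.mem_filter.1 (hL₂ ▸ hZ hℓ)).2.trans (hg ℓ).ge
    refine Nat.le_floor ?_
    by_contra! h2
    have h3 : x ^ 2 * (r / 2) ≤ A.card * y ^ 2 := by
      rw [hy2]
      refine le_trans ?_ h1
      gcongr
      linarith
    have h4 : x ^ 2 * (I / 4) ≤ x ^ 4 * y ^ 2 := by
      calc x ^ 2 * (I / 4) = x ^ 2 * (r / 2) * L.card := by rw [mul_assoc, div_mul_eq_mul_div, hrL]; ring
        _ ≤ A.card * y ^ 2 * L.card := by gcongr
        _ = x ^ 4 * y ^ 2 := by rw [hx4]; ring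
    have h5 : I / 4 ≤ x ^ 2 * y ^ 2 := by
      have : 0 < x ^ 2 := by positivity
      nlinarith
    have h6 : x ^ 2 * y ^ 2 ≤ x ^ 3 * y := by
      calc x ^ 2 * y ^ 2 = x ^ 2 * y * y := by ring
        _ ≤ x ^ 2 * y * x := by gcongr
        _ = x ^ 3 * y := by ring
    linarith
  have hAx : (A.card : ℝ) ≤ x ^ 2 := by
    have h1 : (A.card : ℝ) ≤ y ^ 2 := by rw [hy2]; exact_mod_cast hAB
    have h2 : y ^ 2 ≤ x ^ 2 := by gcongr
    linarith
  have hcard : (L₂.card * A.card : ℝ) ≤ x ^ 4 := by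
    rw [hx4, mul_comm]
    gcongr
  have hE := sum_card_filter_eval_eq_le (p := p) (k := ⌊x ^ 2⌋₊) L₂ A
    (by
      rw [mul_comm]
      exact (Nat.mul_le_mul_left _ (Nat.cast_le.1 hL₂card)).trans hp)
    (Nat.le_floor hAx)
    (fun m => hconc _ (Finset.filter_subset _ _) 0 (by
      intro a _ _ ℓ hℓ ℓ' hℓ' h
      have h1 := (Finset.mem_filter.1 hℓ).2
      have h2 := (Finset.mem_filter.1 hℓ').2
      simp only [h1, h2] at h
      exact Prod.ext (h1.trans h2.symm) (add_left_cancel h)))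
    (fun x₀ y₀ => hconc _ (Finset.filter_subset _ _) x₀ (by
      intro a _ ha ℓ hℓ ℓ' hℓ' h
      have h1 := (Finset.mem_filter.1 hℓ).2
      have h2 := (Finset.mem_filter.1 hℓ').2
      simp only at h
      have h3 : ℓ.1 = ℓ'.1 := by
        apply mul_right_cancel₀ (sub_ne_zero.2 ha)
        linear_combination h - h1 + h2
      rw [h3] at h
      exact Prod.ext h3 (add_left_cancel h)))
  have hsqrt : √(L₂.card * A.card) ≤ x ^ 2 := by
    rw [Real.sqrt_le_left (by positivity)]
    calc (L₂.card * A.card : ℝ) ≤ x ^ 4 := hcard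
      _ = (x ^ 2) ^ 2 := by ring
  have hfl : ((⌊x ^ 2⌋₊ : ℕ) : ℝ) ≤ x ^ 2 := Nat.floor_le (by positivity)
  have hE2 : ∑ v ∈ L₂ ×ˢ A,
      (((L₂ ×ˢ A).filter fun u => u.1.1 * v.2 + u.1.2 = v.1.1 * u.2 + v.1.2).card : ℝ) ≤
        2 * (10 ^ 4 * (x ^ 2 + x ^ 2)) * x ^ 4 := by
    refine hE.trans ?_
    gcongr
  have hcs := sq_sum_card_filter_mem_le A B L₂
  simp only [hg] at hcs
  have h1 : (I / 2) ^ 2 ≤ (200 * (x ^ 3 * y)) ^ 2 := by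
    calc (I / 2) ^ 2 ≤ (∑ ℓ ∈ L₂, g ℓ) ^ 2 := by gcongr
      _ ≤ y ^ 2 * (2 * (10 ^ 4 * (x ^ 2 + x ^ 2)) * x ^ 4) := by
          rw [hy2]
          refine hcs.trans ?_
          gcongr
      _ = (200 * (x ^ 3 * y)) ^ 2 := by ring
  have h2 := (sq_le_sq₀ (by positivity) (by positivity)).1 h1
  linarith

/-- The line `y = m x + n`. -/
def graphLine {F : Type*} [Field F] (ℓ : F × F) : Set (F × F) :=
  {z | z.2 = ℓ.1 * z.1 + ℓ.2}

theorem graphLine_injective {F : Type*} [Field F] :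
    Function.Injective (graphLine : F × F → Set (F × F)) := by
  intro ℓ ℓ' h
  have h0 : ((0 : F), ℓ.2) ∈ graphLine ℓ' := by rw [← h]; simp [graphLine]
  have h1 : ((1 : F), ℓ.1 + ℓ.2) ∈ graphLine ℓ' := by rw [← h]; simp [graphLine]
  simp only [graphLine, Set.mem_ofPred_eq, mul_zero, zero_add, mul_one] at h0 h1
  rw [h0, add_left_inj] at h1
  exact Prod.ext h1 h0

theorem IsLine.eq_graphLine_or {F : Type*} [Field F] {ℓ : Set (F × F)} (h : IsLine ℓ) :
    (∃ m, ℓ = graphLine m) ∨ ∃ x, ℓ = {z | z.1 = x} := by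
  obtain ⟨a, b, c, hab, rfl⟩ := h
  by_cases hb : b = 0
  · have ha : a ≠ 0 := hab.resolve_right (not_not.2 hb)
    refine Or.inr ⟨c / a, ?_⟩
    ext z
    simp only [Set.mem_ofPred_eq, hb]
    rw [eq_div_iff ha, zero_mul, add_zero, mul_comm]
  · refine Or.inl ⟨(-a / b, c / b), ?_⟩
    ext z
    simp only [graphLine, Set.mem_ofPred_eq]
    field_simp
    constructor
    · intro h
      linear_combination h
    · intro h
      linear_combination h

open Classical in
theorem nIncidences_le {F : Type*} [Field F] [Fintype F] (A B : Set F) (L : Set (Set (F × F)))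
    (hL : ∀ ℓ ∈ L, IsLine ℓ) :
    nIncidences (A ×ˢ B) L ≤
      ∑ ℓ : F × F with graphLine ℓ ∈ L,
        (A.toFinset.filter fun a => ℓ.1 * a + ℓ.2 ∈ B.toFinset).card + A.ncard * B.ncard := by
  set S := (Finset.univ.filter fun ℓ : F × F => graphLine ℓ ∈ L).sigma
    fun ℓ => A.toFinset.filter fun a => ℓ.1 * a + ℓ.2 ∈ B.toFinset with hS
  have hsub : {zl : (F × F) × Set (F × F) | zl.1 ∈ A ×ˢ B ∧ zl.2 ∈ L ∧ zl.1 ∈ zl.2} ⊆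
      ((S.image fun s => ((s.2, s.1.1 * s.2 + s.1.2), graphLine s.1)) ∪
        ((A ×ˢ B).toFinset.image fun z => (z, {w : F × F | w.1 = z.1})) :
          Finset ((F × F) × Set (F × F))) := by
    rintro ⟨z, ℓ⟩ ⟨hz, hℓ, hzℓ⟩
    simp only [Finset.coe_union, Finset.coe_image, Set.mem_union, Set.mem_image]
    rcases (hL ℓ hℓ).eq_graphLine_or with ⟨m, rfl⟩ | ⟨x, rfl⟩
    · left
      have h1 : z.2 = m.1 * z.1 + m.2 := hzℓ
      refine ⟨⟨m, z.1⟩, ?_, ?_⟩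
      · rw [Finset.mem_coe, hS, Finset.mem_sigma, Finset.mem_filter, Finset.mem_filter,
          Set.mem_toFinset, Set.mem_toFinset, ← h1]
        exact ⟨⟨Finset.mem_univ _, hℓ⟩, hz.1, hz.2⟩
      · simp only [← h1]
    · right
      have h1 : z.1 = x := hzℓ
      exact ⟨z, by simpa using hz, by rw [h1]⟩
  have h1 := Set.ncard_le_ncard hsub (Finset.finite_toSet _)
  rw [Set.ncard_coe_finset] at h1
  refine (h1.trans (Finset.card_union_le _ _)).trans (Nat.add_le_add ?_ ?_)
  · exact Finset.card_image_le.trans (Finset.card_sigma _ _).le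
  · refine Finset.card_image_le.trans ?_
    rw [← Set.ncard_eq_toFinset_card', Set.ncard_prod]

open Classical in
theorem nIncidences_prod_le {F : Type*} [Field F] [Fintype F] {p : ℕ} [CharP F p] (A B : Set F)
    (L : Set (Set (F × F))) (hAB : A.ncard ≤ B.ncard) (hL : ∀ ℓ ∈ L, IsLine ℓ)
    (hp : A.ncard * L.ncard ≤ p ^ 2) :
    (nIncidences (A ×ˢ B) L : ℝ) ≤
      500 * ((A.ncard : ℝ) ^ (3 / 4 : ℝ) * (B.ncard : ℝ) ^ (1 / 2 : ℝ) *
        (L.ncard : ℝ) ^ (3 / 4 : ℝ) + L.ncard) + A.ncard * B.ncard := by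
  have h1 := nIncidences_le A B L hL
  obtain ⟨L', hL'⟩ : ∃ L', L' = Finset.univ.filter fun ℓ : F × F => graphLine ℓ ∈ L := ⟨_, rfl⟩
  rw [← hL'] at h1
  have hL'card : L'.card ≤ L.ncard := by
    rw [← Set.ncard_coe_finset]
    exact Set.ncard_le_ncard_of_injOn graphLine
      (fun ℓ hℓ => by
        rw [Finset.mem_coe, hL', Finset.mem_filter] at hℓ
        exact hℓ.2)
      graphLine_injective.injOn (Set.toFinite L)
  have hA : A.toFinset.card = A.ncard := (Set.ncard_eq_toFinset_card' A).symm
  have hB : B.toFinset.card = B.ncard := (Set.ncard_eq_toFinset_card' B).symm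
  have hx0 : (0 : ℝ) ≤ A.ncard * L'.card := by positivity
  have h2 := sum_card_filter_mem_le (p := p) A.toFinset B.toFinset L' (by rwa [hA, hB])
    (by rw [hA]; exact (Nat.mul_le_mul_left _ hL'card).trans hp)
    (x := ((A.ncard : ℝ) * L'.card) ^ (1 / 4 : ℝ)) (y := (B.ncard : ℝ) ^ (1 / 2 : ℝ))
    (by positivity) (by positivity)
    (by
      rw [hA, ← Real.rpow_natCast, ← Real.rpow_mul hx0]
      norm_num)
    (by
      rw [hB, ← Real.rpow_natCast, ← Real.rpow_mul (Nat.cast_nonneg _)]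
      norm_num)
  have h3 : (((A.ncard : ℝ) * L'.card) ^ (1 / 4 : ℝ)) ^ 3 * (B.ncard : ℝ) ^ (1 / 2 : ℝ) ≤
      (A.ncard : ℝ) ^ (3 / 4 : ℝ) * (B.ncard : ℝ) ^ (1 / 2 : ℝ) * (L.ncard : ℝ) ^ (3 / 4 : ℝ) := by
    rw [← Real.rpow_natCast, ← Real.rpow_mul hx0, Real.mul_rpow (by positivity) (by positivity)]
    norm_num
    rw [mul_right_comm]
    gcongr
  have h4 : (nIncidences (A ×ˢ B) L : ℝ) ≤
      ∑ ℓ ∈ L', ((A.toFinset.filter fun a => ℓ.1 * a + ℓ.2 ∈ B.toFinset).card : ℝ) +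
        (A.ncard : ℝ) * B.ncard := by
    exact_mod_cast h1
  have h5 : (L'.card : ℝ) ≤ L.ncard := by exact_mod_cast hL'card
  linarith

end Incidences

/-- the Stevens–de Zeeuw incidence bound for Cartesian products:
if $|A| \le |B|$ and $|A||L| \le c p^2$, then
$I(A \times B, L) \le C(|A|^{3/4}|B|^{1/2}|L|^{3/4} + |A||B| + |L|)$. -/
theorem statement9 :
    ∃ c K : ℝ, 0 < c ∧ 0 < K ∧
      ∀ (p : ℕ) [Fact p.Prime] (A B : Set (ZMod p)) (L : Set (Set (ZMod p × ZMod p))),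
        A.ncard ≤ B.ncard →
        (∀ ℓ ∈ L, IsLine ℓ) →
        (A.ncard : ℝ) * (L.ncard : ℝ) ≤ c * (p : ℝ) ^ (2 : ℕ) →
        (nIncidences (A ×ˢ B) L : ℝ) ≤
          K * ((A.ncard : ℝ) ^ (3/4 : ℝ) * (B.ncard : ℝ) ^ (1/2 : ℝ) * (L.ncard : ℝ) ^ (3/4 : ℝ)
              + (A.ncard : ℝ) * (B.ncard : ℝ) + (L.ncard : ℝ)) := by
  refine ⟨1, 500, one_pos, by norm_num, fun p _ A B L hAB hL hp => ?_⟩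
  rw [one_mul] at hp
  have h1 := nIncidences_prod_le (p := p) A B L hAB hL (by exact_mod_cast hp)
  have h2 : (0 : ℝ) ≤ (A.ncard : ℝ) * B.ncard := by positivity
  linarith
end

section
/- Let L and R be nonempty finite sets and let E ⊆ L × R be nonempty. Then there exist nonempty subsets L' ⊆ L and R' ⊆ R such that, setting E' = E ∩ (L' × R') and defining the degree of v ∈ L' as #{u ∈ R' : (v,u) ∈ E'} and the degree of u ∈ R' as #{v ∈ L' : (v,u) ∈ E'}, we have: (min over v ∈ L' of deg(v)) · (min over u ∈ R' of deg(u)) > |E|^2 / (4|L|·|R|), and |E'|^2 / (|L'|·|R'|) ≥ |E|^2 / (|L|·|R|). -/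
/-- If deleting a vertex of degree `d` from a side of size `l` does not increase the density
`e ^ 2 / (l * r)` of a bipartite graph with `e` edges, then `e / (2 * l) < d`. -/
theorem div_two_mul_lt_of_sq_sub_le {e d l r : ℝ} (he : 0 < e) (hd : 0 ≤ d) (hl : 0 < l)
    (hr : 0 < r) (h : (e - d) ^ 2 ≤ e ^ 2 / (l * r) * ((l - 1) * r)) : e / (2 * l) < d := by
  have h1 : (e - d) ^ 2 * l ≤ e ^ 2 * (l - 1) := by
    have : e ^ 2 / (l * r) * ((l - 1) * r) = e ^ 2 * (l - 1) / l := by field_simp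
    rwa [this, le_div_iff₀ hl] at h
  have hd : 0 < d := by
    refine hd.lt_of_ne fun h0 => ?_
    subst h0
    nlinarith [pow_pos he 2]
  rw [div_lt_iff₀ (by positivity)]
  by_contra! hle
  nlinarith [mul_pos (pow_pos hd 2) hl, mul_le_mul_of_nonneg_left hle he.le]

/-- The edges of `E` with both ends in the vertex sets `A` and `B`. -/
def inducedEdges {α β : Type*} [DecidableEq α] [DecidableEq β]
    (E : Finset (α × β)) (A : Finset α) (B : Finset β) : Finset (α × β) :=
  E.filter fun e => e.1 ∈ A ∧ e.2 ∈ B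

section inducedEdges

variable {α β : Type*} [DecidableEq α] [DecidableEq β] (E : Finset (α × β))
  (A : Finset α) (B : Finset β)

theorem card_inducedEdges_erase_left (v : α) :
    ((inducedEdges E (A.erase v) B).card : ℝ) = (inducedEdges E A B).card -
      ((inducedEdges E A B).filter fun e => e.1 = v).card := by
  have h := Finset.card_filter_add_card_filter_not (s := inducedEdges E A B) (fun e => e.1 = v)
  have h' : inducedEdges E (A.erase v) B = (inducedEdges E A B).filter fun e => ¬ e.1 = v := by
    ext e
    simp only [inducedEdges, Finset.mem_filter, Finset.mem_erase]
    tauto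
  rw [h', ← h]
  push_cast
  ring

theorem card_inducedEdges_erase_right (u : β) :
    ((inducedEdges E A (B.erase u)).card : ℝ) = (inducedEdges E A B).card -
      ((inducedEdges E A B).filter fun e => e.2 = u).card := by
  have h := Finset.card_filter_add_card_filter_not (s := inducedEdges E A B) (fun e => e.2 = u)
  have h' : inducedEdges E A (B.erase u) = (inducedEdges E A B).filter fun e => ¬ e.2 = u := by
    ext e
    simp only [inducedEdges, Finset.mem_filter, Finset.mem_erase]
    tauto
  rw [h', ← h]
  push_cast
  ring

theorem card_inducedEdges_sq_le {q : ℝ}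
    (h : ((inducedEdges E A B).card : ℝ) ^ 2 / ((A.card : ℝ) * B.card) ≤ q) :
    ((inducedEdges E A B).card : ℝ) ^ 2 ≤ q * ((A.card : ℝ) * B.card) := by
  rcases A.eq_empty_or_nonempty with rfl | hA
  · simp [inducedEdges]
  rcases B.eq_empty_or_nonempty with rfl | hB
  · simp [inducedEdges]
  have := hA.card_pos
  have := hB.card_pos
  rwa [div_le_iff₀ (by positivity)] at h

end inducedEdges

/-- the pruning lemma for bipartite graphs. For a bipartite graph with
parts `L`, `R` and edge set `E ⊆ L × R`, there is an induced subgraph on `L' ⊆ L`,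
`R' ⊆ R` with edge set `E' = E ∩ (L' × R')` in which the product of the minimum degrees
on the two sides exceeds `|E|^2 / (4|L||R|)`, and `|E'|^2/(|L'||R'|) ≥ |E|^2/(|L||R|)`. -/
theorem statement10 {α β : Type*} [DecidableEq α] [DecidableEq β]
    (L : Finset α) (R : Finset β) (E : Finset (α × β))
    (hL : L.Nonempty) (hR : R.Nonempty) (hE : E.Nonempty) (hsub : E ⊆ L ×ˢ R) :
    ∃ (L' : Finset α) (R' : Finset β) (hL' : L'.Nonempty) (hR' : R'.Nonempty),
      L' ⊆ L ∧ R' ⊆ R ∧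
      (E.card : ℝ) ^ (2 : ℕ) / (4 * (L.card : ℝ) * (R.card : ℝ)) <
        ((L'.inf' hL' fun v =>
            ((E.filter fun e => e.1 ∈ L' ∧ e.2 ∈ R').filter fun e => e.1 = v).card : ℝ)) *
        ((R'.inf' hR' fun u =>
            ((E.filter fun e => e.1 ∈ L' ∧ e.2 ∈ R').filter fun e => e.2 = u).card : ℝ)) ∧
      (E.card : ℝ) ^ (2 : ℕ) / ((L.card : ℝ) * (R.card : ℝ)) ≤
        ((E.filter fun e => e.1 ∈ L' ∧ e.2 ∈ R').card : ℝ) ^ (2 : ℕ) /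
          ((L'.card : ℝ) * (R'.card : ℝ)) := by
  obtain ⟨⟨A, B⟩, hAB, hmax⟩ := (L.powerset ×ˢ R.powerset).exists_max_image
    (fun p => ((inducedEdges E p.1 p.2).card : ℝ) ^ 2 / ((p.1.card : ℝ) * p.2.card))
    ⟨(L, R), by simp⟩
  simp only [Finset.mem_product, Finset.mem_powerset, and_imp, Prod.forall] at hAB hmax
  obtain ⟨hAL, hBR⟩ := hAB
  have hfull : inducedEdges E L R = E :=
    Finset.filter_true_of_mem fun e he => Finset.mem_product.mp (hsub he)
  have hdens := hmax L R subset_rfl subset_rfl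
  rw [hfull] at hdens
  have hLpos : (0 : ℝ) < L.card := by exact_mod_cast hL.card_pos
  have hRpos : (0 : ℝ) < R.card := by exact_mod_cast hR.card_pos
  have hEpos : (0 : ℝ) < E.card := by exact_mod_cast hE.card_pos
  have hpos : 0 < ((inducedEdges E A B).card : ℝ) ^ 2 / ((A.card : ℝ) * B.card) :=
    lt_of_lt_of_le (by positivity) hdens
  have hA : A.Nonempty := by
    rw [Finset.nonempty_iff_ne_empty]
    rintro rfl
    simp at hpos
  have hB : B.Nonempty := by
    rw [Finset.nonempty_iff_ne_empty]
    rintro rfl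
    simp at hpos
  have hApos : (0 : ℝ) < A.card := by exact_mod_cast hA.card_pos
  have hBpos : (0 : ℝ) < B.card := by exact_mod_cast hB.card_pos
  have hepos : (0 : ℝ) < (inducedEdges E A B).card := by
    refine (Nat.cast_nonneg _).lt_of_ne fun h0 => ?_
    simp [← h0] at hpos
  have hleft : ((inducedEdges E A B).card : ℝ) / (2 * A.card) < A.inf' hA fun v =>
      (((inducedEdges E A B).filter fun e => e.1 = v).card : ℝ) := by
    refine (Finset.lt_inf'_iff hA).mpr fun v hv => ?_
    refine div_two_mul_lt_of_sq_sub_le hepos (Nat.cast_nonneg _) hApos hBpos ?_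
    have h := card_inducedEdges_sq_le E _ _
      (hmax (A.erase v) B ((A.erase_subset v).trans hAL) hBR)
    rwa [card_inducedEdges_erase_left, Finset.cast_card_erase_of_mem hv] at h
  have hright : ((inducedEdges E A B).card : ℝ) / (2 * B.card) < B.inf' hB fun u =>
      (((inducedEdges E A B).filter fun e => e.2 = u).card : ℝ) := by
    refine (Finset.lt_inf'_iff hB).mpr fun u hu => ?_
    refine div_two_mul_lt_of_sq_sub_le hepos (Nat.cast_nonneg _) hBpos hApos ?_
    have h := card_inducedEdges_sq_le E _ _
      (hmax A (B.erase u) hAL ((B.erase_subset u).trans hBR))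
    rwa [card_inducedEdges_erase_right, Finset.cast_card_erase_of_mem hu,
      mul_comm (A.card : ℝ) (B.card : ℝ), mul_comm (A.card : ℝ) ((B.card : ℝ) - 1)] at h
  refine ⟨A, B, hA, hB, hAL, hBR, ?_, hdens⟩
  calc (E.card : ℝ) ^ 2 / (4 * (L.card : ℝ) * R.card)
      = (E.card : ℝ) ^ 2 / ((L.card : ℝ) * R.card) / 4 := by field_simp
    _ ≤ ((inducedEdges E A B).card : ℝ) ^ 2 / ((A.card : ℝ) * B.card) / 4 := by gcongr
    _ = ((inducedEdges E A B).card : ℝ) / (2 * A.card) *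
          (((inducedEdges E A B).card : ℝ) / (2 * B.card)) := by field_simp; norm_num
    _ < _ := mul_lt_mul'' hleft hright (by positivity) (by positivity)
end

section
/- There is an absolute constant c > 0 such that the following holds. Let q be a prime power, let Y ⊆ F_q be nonempty, and let E ⊆ F_q^2. Then there exists y ∈ Y such that #{a·y + b : (a, b) ∈ E} ≥ c · min( |Y|^{1/2} q^{1/2}, |Y|^{1/2} |E| / q, |E| ). -/
open Finset in
/-- The Cauchy–Schwarz lower bound for the number of coincidences of a map. -/
theorem card_sq_le_card_mul_card_coincidences {α β : Type*} [DecidableEq α] [DecidableEq β]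
    (f : α → β) (E : Finset α) (S : Finset β) (hS : ∀ a ∈ E, f a ∈ S) :
    #E ^ 2 ≤ #S * #{p ∈ E ×ˢ E | f p.1 = f p.2} := by
  have hE : #E = ∑ b ∈ S, #{a ∈ E | f a = b} := card_eq_sum_card_fiberwise hS
  have hP : #{p ∈ E ×ˢ E | f p.1 = f p.2} = ∑ b ∈ S, #{a ∈ E | f a = b} ^ 2 := by
    rw [card_eq_sum_card_fiberwise (f := fun p => f p.1) (t := S)]
    · refine sum_congr rfl fun b _ => ?_
      rw [sq, ← card_product]
      congr 1
      ext ⟨x, y⟩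
      simp only [mem_filter, mem_product]
      grind
    · intro p hp
      exact hS _ (mem_product.1 (mem_filter.1 hp).1).1
  rw [hE, hP]
  exact sq_sum_le_card_mul_sum_sq

open Finset in
/-- Two distinct points of the plane have the same image under `(a, b) ↦ a * y + b` for at most
one `y`. -/
theorem card_filter_coincident_slopes_le {F : Type*} [Field F] [Fintype F] [DecidableEq F]
    (z w : F × F) :
    #{y : F | z.1 * y + z.2 = w.1 * y + w.2} ≤ 1 + if z = w then Fintype.card F else 0 := by
  split_ifs with h
  · exact (card_le_univ _).trans (Nat.le_add_left _ _)
  · refine card_le_one.2 fun s hs t ht => ?_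
    simp only [mem_filter, mem_univ, true_and] at hs ht
    have h1 : (z.1 - w.1) * (s - t) = 0 := by linear_combination hs - ht
    rcases mul_eq_zero.1 h1 with h1 | h1
    · refine absurd (Prod.ext (sub_eq_zero.1 h1) ?_) h
      linear_combination hs - s * h1
    · exact sub_eq_zero.1 h1

open Finset in
theorem sum_card_coincidences_le {F : Type*} [Field F] [Fintype F] [DecidableEq F]
    (E : Finset (F × F)) :
    ∑ y : F, #{p ∈ E ×ˢ E | p.1.1 * y + p.1.2 = p.2.1 * y + p.2.2} ≤
      #E ^ 2 + #E * Fintype.card F := by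
  calc ∑ y : F, #{p ∈ E ×ˢ E | p.1.1 * y + p.1.2 = p.2.1 * y + p.2.2}
      = ∑ p ∈ E ×ˢ E, #{y : F | p.1.1 * y + p.1.2 = p.2.1 * y + p.2.2} := by
        simp only [card_filter]
        exact sum_comm
    _ ≤ ∑ p ∈ E ×ˢ E, (1 + if p.1 = p.2 then Fintype.card F else 0) :=
        sum_le_sum fun p _ => card_filter_coincident_slopes_le p.1 p.2
    _ = #E ^ 2 + #E * Fintype.card F := by
        rw [sum_add_distrib, sum_product (f := fun p => if p.1 = p.2 then Fintype.card F else 0)]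
        simp [sq]

open Finset in
/-- Some `y ∈ Y` has an image of size at least `|Y| q |E| / (|Y| |E| + q ^ 2)`. -/
theorem exists_card_image_ge {F : Type*} [Field F] [Fintype F] [DecidableEq F]
    (Y : Finset F) (E : Finset (F × F)) (hY : Y.Nonempty) :
    ∃ y ∈ Y, (#Y : ℝ) * Fintype.card F * #E ≤
      #(E.image fun z => z.1 * y + z.2) * (#Y * #E + (Fintype.card F : ℝ) ^ 2) := by
  set q : ℝ := (Fintype.card F : ℝ) with hq
  have hq0 : 0 < q := by rw [hq]; exact_mod_cast Fintype.card_pos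
  rcases E.eq_empty_or_nonempty with rfl | hE
  · obtain ⟨y, hy⟩ := hY
    exact ⟨y, hy, by simp⟩
  have hN : (0 : ℝ) < #E := by exact_mod_cast hE.card_pos
  let e : F → ℝ := fun y => #{p ∈ E ×ˢ E | p.1.1 * y + p.1.2 = p.2.1 * y + p.2.2}
  have hcs (y : F) (S : Finset F) (hS : ∀ z ∈ E, z.1 * y + z.2 ∈ S) :
      (#E : ℝ) ^ 2 ≤ #S * e y := by
    simp only [e]
    exact_mod_cast card_sq_le_card_mul_card_coincidences (fun z : F × F => z.1 * y + z.2) E S hS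
  have hlow (y : F) : 0 ≤ e y - (#E : ℝ) ^ 2 / q := by
    rw [sub_nonneg, div_le_iff₀' hq0, hq, ← card_univ]
    exact hcs y univ fun _ _ => mem_univ _
  have htot : ∑ y, e y ≤ (#E : ℝ) ^ 2 + #E * q := by
    simp only [e, hq]
    exact_mod_cast sum_card_coincidences_le E
  have hsum : ∑ y ∈ Y, (e y - (#E : ℝ) ^ 2 / q) ≤ #E * q := by
    refine (sum_le_univ_sum_of_nonneg hlow).trans ?_
    rw [sum_sub_distrib, sum_const, card_univ, nsmul_eq_mul, ← hq, mul_div_cancel₀ _ hq0.ne']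
    linarith
  have hn : (0 : ℝ) < #Y := by exact_mod_cast hY.card_pos
  obtain ⟨y, hy, hle⟩ : ∃ y ∈ Y, e y - (#E : ℝ) ^ 2 / q ≤ #E * q / #Y := by
    refine exists_le_of_sum_le hY (hsum.trans_eq ?_)
    rw [sum_const, nsmul_eq_mul, mul_div_cancel₀ _ hn.ne']
  refine ⟨y, hy, ?_⟩
  have hK := hcs y (E.image fun z => z.1 * y + z.2) fun z hz => mem_image_of_mem _ hz
  set K : ℝ := (#(E.image fun z => z.1 * y + z.2) : ℝ)
  have hK' : (#E : ℝ) ^ 2 ≤ K * ((#E : ℝ) ^ 2 / q + #E * q / #Y) :=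
    hK.trans (mul_le_mul_of_nonneg_left (by linarith) (Nat.cast_nonneg _))
  have hid : K * ((#E : ℝ) ^ 2 / q + #E * q / #Y) * (q * #Y) = K * (#Y * #E + q ^ 2) * #E := by
    field_simp
  refine le_of_mul_le_mul_right ?_ hN
  rw [← hid]
  linarith [mul_le_mul_of_nonneg_right hK' (mul_pos hq0 hn).le]

/-- for any nonempty `Y ⊆ F_q` and `E ⊆ F_q^2` there is `y ∈ Y` with
`#{ay + b : (a,b) ∈ E} ≥ c·min(|Y|^{1/2} q^{1/2}, |Y|^{1/2}|E|/q, |E|)`. -/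
theorem statement11 :
    ∃ c : ℝ, 0 < c ∧
      ∀ (F : Type) [Field F] [Fintype F] (Y : Set F) (E : Set (F × F)),
        Y.Nonempty →
        ∃ y ∈ Y,
          c * min ((Y.ncard : ℝ) ^ (1/2 : ℝ) * (Fintype.card F : ℝ) ^ (1/2 : ℝ))
              (min ((Y.ncard : ℝ) ^ (1/2 : ℝ) * (E.ncard : ℝ) / (Fintype.card F : ℝ))
                  (E.ncard : ℝ)) ≤
            (((fun z : F × F => z.1 * y + z.2) '' E).ncard : ℝ) := by
  classical
  refine ⟨1 / 2, by norm_num, fun F _ _ Y E hY => ?_⟩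
  lift Y to Finset F using Y.toFinite
  lift E to Finset (F × F) using E.toFinite
  obtain ⟨y, hy, h⟩ := exists_card_image_ge Y E (Finset.coe_nonempty.1 hY)
  refine ⟨y, hy, ?_⟩
  rw [← Finset.coe_image]
  simp only [Set.ncard_coe_finset, ← Real.sqrt_eq_rpow]
  have hn : (1 : ℝ) ≤ Y.card := by exact_mod_cast (Finset.coe_nonempty.1 hY).card_pos
  have hnq : (Y.card : ℝ) ≤ Fintype.card F := by exact_mod_cast Y.card_le_univ
  set K : ℝ := ((E.image fun z => z.1 * y + z.2).card : ℝ)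
  set n : ℝ := (Y.card : ℝ)
  set q : ℝ := (Fintype.card F : ℝ)
  have hN : (0 : ℝ) ≤ E.card := Nat.cast_nonneg _
  set N : ℝ := (E.card : ℝ)
  have hK : 0 ≤ K := Nat.cast_nonneg _
  have hq : 0 < q := by linarith
  rcases le_total (q ^ 2) (n * N) with hc | hc
  · have hnN : 0 < n * N := lt_of_lt_of_le (by positivity) hc
    have h2 : q ≤ 2 * K := by
      refine le_of_mul_le_mul_right ?_ hnN
      linarith [mul_le_mul_of_nonneg_left hc hK]
    have h3 : √n * √q ≤ q :=
      (mul_le_mul_of_nonneg_right (Real.sqrt_le_sqrt hnq) (Real.sqrt_nonneg _)).trans_eq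
        (Real.mul_self_sqrt hq.le)
    linarith [min_le_left (√n * √q) (min (√n * N / q) N)]
  · have h2 : n * N / q ≤ 2 * K := by
      rw [div_le_iff₀ hq]
      refine le_of_mul_le_mul_right ?_ hq
      linarith [mul_le_mul_of_nonneg_left hc hK]
    have h3 : √n * N / q ≤ n * N / q := by
      gcongr
      exact Real.sqrt_le_iff.2 ⟨by linarith, le_self_pow₀ hn two_ne_zero⟩
    linarith [(min_le_right (√n * √q) (min (√n * N / q) N)).trans (min_le_left _ _)]
end

section
/- There is an absolute constant c > 0 such that the following holds. Let q be a prime power, let Y ⊆ F_q \ {0} be nonempty, let C ⊆ F_q, and let E = C × C ⊆ F_q^2. Then there exists y ∈ Y such that #{a·y + b : (a, b) ∈ E} ≥ c · min( q, |Y|·|C|^2 / q ). -/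
open Finset in
/-- The Cauchy–Schwarz bound relating the image size and the number of collisions of a map. -/
theorem card_sq_le_card_image_mul_card_collisions {α β : Type*} [DecidableEq β]
    (s : Finset α) (f : α → β) :
    #s ^ 2 ≤ #(s.image f) * #{p ∈ s ×ˢ s | f p.1 = f p.2} := by
  have h : #{p ∈ s ×ˢ s | f p.1 = f p.2} = ∑ t ∈ s.image f, #{a ∈ s | f a = t} ^ 2 := by
    rw [card_eq_sum_card_fiberwise (f := fun p : α × α => f p.1) (t := s.image f)]
    · refine sum_congr rfl fun t _ => ?_
      rw [sq, ← card_product]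
      congr 1
      ext ⟨a, b⟩
      simp only [mem_filter, mem_product]
      grind
    · intro p hp
      simp only [coe_filter, mem_product, Set.mem_ofPred_eq] at hp
      exact mem_coe.2 (mem_image_of_mem f hp.1.1)
  rw [h, card_eq_sum_card_image f s]
  exact sq_sum_le_card_mul_sum_sq

section LineMaps

variable {F : Type*} [Field F] [Fintype F] [DecidableEq F]

open Finset in
/-- Two distinct affine maps over a field agree in at most one point. -/
theorem card_filter_mul_add_eq_le (p p' : F × F) :
    #{y : F | p.1 * y + p.2 = p'.1 * y + p'.2} ≤ (if p = p' then Fintype.card F else 0) + 1 := by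
  split_ifs with h
  · exact (card_le_univ _).trans (Nat.le_succ _)
  · rw [zero_add, card_le_one]
    intro x hx y hy
    simp only [mem_filter, mem_univ, true_and] at hx hy
    by_contra hxy
    have h1 : p.1 = p'.1 := by
      have : (p.1 - p'.1) * (x - y) = 0 := by linear_combination hx - hy
      rcases mul_eq_zero.1 this with h0 | h0
      · exact sub_eq_zero.1 h0
      · exact absurd (sub_eq_zero.1 h0) hxy
    refine h (Prod.ext h1 ?_)
    rw [h1] at hx
    exact add_left_cancel hx

open Finset in
theorem sum_card_collisions_le (E : Finset (F × F)) :
    ∑ y : F, #{p ∈ E ×ˢ E | p.1.1 * y + p.1.2 = p.2.1 * y + p.2.2} ≤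
      Fintype.card F * #E + #E ^ 2 := by
  calc
    _ = ∑ p ∈ E ×ˢ E, #{y : F | p.1.1 * y + p.1.2 = p.2.1 * y + p.2.2} := by
      simp only [card_filter]
      exact sum_comm
    _ ≤ ∑ p ∈ E ×ˢ E, ((if p.1 = p.2 then Fintype.card F else 0) + 1) :=
      sum_le_sum fun p _ => card_filter_mul_add_eq_le p.1 p.2
    _ = Fintype.card F * #E + #E ^ 2 := by
      rw [sum_add_distrib, sum_product]
      simp [sq, mul_comm]

open Finset in
theorem exists_card_mul_collisions_le (Y : Finset F) (hY : Y.Nonempty) (E : Finset (F × F)) :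
    ∃ y ∈ Y, (#Y : ℝ) * (Fintype.card F *
      #{p ∈ E ×ˢ E | p.1.1 * y + p.1.2 = p.2.1 * y + p.2.2} - #E ^ 2) ≤
      Fintype.card F ^ 2 * #E := by
  set q := (Fintype.card F : ℝ)
  have hY0 : (0 : ℝ) < #Y := by exact_mod_cast hY.card_pos
  set k := fun y : F => (#{p ∈ E ×ˢ E | p.1.1 * y + p.1.2 = p.2.1 * y + p.2.2} : ℝ)
  have hnonneg (y : F) : 0 ≤ q * k y - #E ^ 2 := by
    have h := card_sq_le_card_image_mul_card_collisions E fun z : F × F => z.1 * y + z.2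
    have h' := h.trans (Nat.mul_le_mul_right _ (card_le_univ _))
    rw [sub_nonneg]
    simp only [q, k]
    exact_mod_cast h'
  have hsum : ∑ y ∈ Y, (q * k y - #E ^ 2) ≤ ∑ _y ∈ Y, q ^ 2 * #E / #Y := by
    have htotal : ∑ y, k y ≤ q * #E + #E ^ 2 := by
      simp only [q, k]
      exact_mod_cast sum_card_collisions_le E
    calc
      _ ≤ ∑ y, (q * k y - #E ^ 2) :=
        sum_le_sum_of_subset_of_nonneg (subset_univ Y) fun y _ _ => hnonneg y
      _ = q * ∑ y, k y - q * #E ^ 2 := by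
        rw [sum_sub_distrib, ← mul_sum, sum_const, card_univ, nsmul_eq_mul]
      _ ≤ q * (q * #E + #E ^ 2) - q * #E ^ 2 := by gcongr
      _ = ∑ _y ∈ Y, q ^ 2 * #E / #Y := by
        rw [sum_const, nsmul_eq_mul]
        field_simp
        ring
  obtain ⟨y, hy, h⟩ := exists_le_of_sum_le hY hsum
  refine ⟨y, hy, ?_⟩
  rw [le_div_iff₀ hY0] at h
  linarith

open Finset in
theorem exists_half_mul_min_le_card_image (Y : Finset F) (hY : Y.Nonempty)
    (E : Finset (F × F)) :
    ∃ y ∈ Y, (1 / 2 : ℝ) * min (Fintype.card F : ℝ) (#Y * #E / Fintype.card F) ≤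
      #(E.image fun z => z.1 * y + z.2) := by
  obtain ⟨y, hy, h⟩ := exists_card_mul_collisions_le Y hY E
  refine ⟨y, hy, ?_⟩
  rcases E.eq_empty_or_nonempty with rfl | hE
  · simp
  have hcs : (#E : ℝ) ^ 2 ≤ #(E.image fun z => z.1 * y + z.2) *
      #{p ∈ E ×ˢ E | p.1.1 * y + p.1.2 = p.2.1 * y + p.2.2} := by
    exact_mod_cast card_sq_le_card_image_mul_card_collisions E fun z : F × F => z.1 * y + z.2
  have hq : (0 : ℝ) < Fintype.card F := by exact_mod_cast Fintype.card_pos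
  have hE0 : (0 : ℝ) < #E := by exact_mod_cast hE.card_pos
  have hY0 : (0 : ℝ) < #Y := by exact_mod_cast hY.card_pos
  have hm1 := min_le_left (Fintype.card F : ℝ) (#Y * #E / Fintype.card F)
  have hm2 := min_le_right (Fintype.card F : ℝ) (#Y * #E / Fintype.card F)
  rw [le_div_iff₀ hq] at hm2
  generalize min (Fintype.card F : ℝ) (#Y * #E / Fintype.card F) = m at *
  generalize (#{p ∈ E ×ˢ E | p.1.1 * y + p.1.2 = p.2.1 * y + p.2.2} : ℝ) = k at *
  have hN : (0 : ℝ) ≤ #(E.image fun z => z.1 * y + z.2) := Nat.cast_nonneg _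
  generalize (#(E.image fun z => z.1 * y + z.2) : ℝ) = N at *
  generalize (Fintype.card F : ℝ) = q at *
  generalize (#E : ℝ) = e at *
  generalize (#Y : ℝ) = u at *
  have hlower : q * (u * e) ≤ N * (u * e + q ^ 2) := by
    refine le_of_mul_le_mul_right ?_ hE0
    calc
      q * (u * e) * e = u * q * e ^ 2 := by ring
      _ ≤ u * q * (N * k) := by gcongr
      _ = N * (u * (q * k - e ^ 2) + u * e ^ 2) := by ring
      _ ≤ N * (q ^ 2 * e + u * e ^ 2) := by gcongr
      _ = N * (u * e + q ^ 2) * e := by ring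
  have hupper : m * (u * e + q ^ 2) ≤ 2 * (q * (u * e)) := by
    have h1 := mul_le_mul_of_nonneg_right hm1 (mul_pos hY0 hE0).le
    have h2 := mul_le_mul_of_nonneg_right hm2 hq.le
    linarith
  refine le_of_mul_le_mul_right ?_ (by positivity : 0 < u * e + q ^ 2)
  linarith

end LineMaps

/-- for any nonempty `Y ⊆ F_q \ {0}` and `E = C × C` there is `y ∈ Y` with
`#{ay + b : (a,b) ∈ E} ≥ c·min(q, |Y||C|^2/q)`. -/
theorem statement12 :
    ∃ c : ℝ, 0 < c ∧
      ∀ (F : Type) [Field F] [Fintype F] (Y : Set F) (C : Set F),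
        Y.Nonempty → (0 : F) ∉ Y →
        ∃ y ∈ Y,
          c * min ((Fintype.card F : ℝ))
              ((Y.ncard : ℝ) * (C.ncard : ℝ) ^ (2 : ℕ) / (Fintype.card F : ℝ)) ≤
            (((fun z : F × F => z.1 * y + z.2) '' (C ×ˢ C)).ncard : ℝ) := by
  classical
  refine ⟨1 / 2, by norm_num, fun F _ _ Y C hY _ => ?_⟩
  obtain ⟨y, hy, h⟩ := exists_half_mul_min_le_card_image Y.toFinset
    (Set.toFinset_nonempty.2 hY) (C.toFinset ×ˢ C.toFinset)
  refine ⟨y, Set.mem_toFinset.1 hy, ?_⟩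
  have himage : (fun z : F × F => z.1 * y + z.2) '' (C ×ˢ C) =
      ((C.toFinset ×ˢ C.toFinset).image fun z => z.1 * y + z.2 : Finset F) := by
    simp
  rw [himage, Set.ncard_coe_finset, Set.ncard_eq_toFinset_card' Y, Set.ncard_eq_toFinset_card' C]
  rwa [Finset.card_product, Nat.cast_mul, ← sq] at h
end
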